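/- There is a positive absolute constant C such that the following holds. If Assumption (A) holds, then the number of characters ψ ∈ Ψ for which the inequality |X₄(D⁸,ψ)| + ∫_{D⁴}^{D⁸} |X₄(x,ψ)|·x^{-1} dx < 𝓛^{-633} FAILS is at most C·𝒫·𝓛^{-739}. -/

import Mathlib

open scoped Classical

noncomputable section

/-- The Dirichlet L-function of `χ` (extended to modulus `0` by `0`, a case never used below). -/
def Lfun {N : ℕ} (χ : DirichletCharacter ℂ N) (s : ℂ) : ℂ :=
  if h : N = 0 then 0
  else
    haveI : NeZero N := ⟨h⟩
    DirichletCharacter.LFunction χ s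

/-- A Dirichlet character is *real* if all of its values are real numbers. -/
def IsRealChar {N : ℕ} (χ : DirichletCharacter ℂ N) : Prop :=
  ∀ a : ZMod N, (χ a).im = 0

/-- `𝓛 = log D`. -/
def bigL (D : ℕ) : ℝ := Real.log D

/-- `P = exp (𝓛 ^ 9)`. -/
def bigP (D : ℕ) : ℝ := Real.exp (bigL D ^ 9)

/-- Assumption (A): `L(1, χ) < 𝓛 ^ (-2022)`. -/
def AssumptionA (D : ℕ) (χ : DirichletCharacter ℂ D) : Prop :=
  (Lfun χ 1).re < bigL D ^ (-2022 : ℤ)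

/-- `p ~ P`, i.e. `p` is a prime with `P < p < P * (1 + 𝓛 ^ (-68))`. -/
def SimP (D p : ℕ) : Prop :=
  p.Prime ∧ bigP D < (p : ℝ) ∧ (p : ℝ) < bigP D * (1 + bigL D ^ (-68 : ℤ))

/-- The finite set of primes `p ~ P`. -/
def primesP (D : ℕ) : Finset ℕ :=
  (Finset.range ⌈2 * bigP D⌉₊).filter (SimP D)

/-- `𝒫 = ∑_{p ~ P} p`. -/
def calP (D : ℕ) : ℝ := ∑ p ∈ primesP D, (p : ℝ)

/-- `ν(n) = ∑_{d ∣ n} χ(d)`. -/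
def nuF (D : ℕ) (χ : DirichletCharacter ℂ D) (n : ℕ) : ℂ :=
  ∑ d ∈ n.divisors, χ (d : ZMod D)

/-- `υ(n) = ∑_{ab = n} μ(a) μ(b) χ(b)`. -/
def upsF (D : ℕ) (χ : DirichletCharacter ℂ D) (n : ℕ) : ℂ :=
  ∑ d ∈ n.divisors,
    ((ArithmeticFunction.moebius (n / d) : ℤ) : ℂ) * ((ArithmeticFunction.moebius d : ℤ) : ℂ) *
      χ (d : ZMod D)

/-- `t₀ = 𝓛 ^ 519`. -/
def t0 (D : ℕ) : ℝ := bigL D ^ 519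

/-- `s₀ = 1/2 + 2 π i t₀`. -/
def s0 (D : ℕ) : ℂ := 1 / 2 + 2 * (Real.pi : ℂ) * Complex.I * (t0 D : ℂ)

/-- `𝓛₁ = 𝓛 ^ 405`. -/
def bigL1 (D : ℕ) : ℝ := bigL D ^ 405

/-- `ν` truncated to `n ≤ D ^ 4`, as an arithmetic function. -/
def nuT (D : ℕ) (χ : DirichletCharacter ℂ D) : ArithmeticFunction ℂ :=
  ⟨fun n => if n = 0 then 0 else if n ≤ D ^ 4 then nuF D χ n else 0, by simp⟩

/-- `υ` truncated to `n ≤ D ^ 4`, as an arithmetic function. -/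
def upsT (D : ℕ) (χ : DirichletCharacter ℂ D) : ArithmeticFunction ℂ :=
  ⟨fun n => if n = 0 then 0 else if n ≤ D ^ 4 then upsF D χ n else 0, by simp⟩

/-- `ν₂₀`, the 20-fold Dirichlet convolution of the truncation of `ν`. -/
def nu20 (D : ℕ) (χ : DirichletCharacter ℂ D) (n : ℕ) : ℂ := (nuT D χ ^ 20) n

/-- `υ₂₀`, the 20-fold Dirichlet convolution of the truncation of `υ`. -/
def ups20 (D : ℕ) (χ : DirichletCharacter ℂ D) (n : ℕ) : ℂ := (upsT D χ ^ 20) n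

/-- `ς(n) = ∑_{lm = n, l ≤ D⁴, m ≤ D⁴} ν(l) υ(m)`. -/
def sigF (D : ℕ) (χ : DirichletCharacter ℂ D) (n : ℕ) : ℂ :=
  ∑ d ∈ n.divisors,
    if d ≤ D ^ 4 ∧ n / d ≤ D ^ 4 then nuF D χ d * upsF D χ (n / d) else 0

/-- `X₁(x, ψ) = ∑_{n ≤ x} ν₂₀(n) ψ(n) n^{-s₀}`. -/
def X1 (D : ℕ) (χ : DirichletCharacter ℂ D) {p : ℕ} (ψ : DirichletCharacter ℂ p) (x : ℝ) : ℂ :=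
  ∑ n ∈ Finset.Icc 1 ⌊x⌋₊, nu20 D χ n * ψ (n : ZMod p) * (n : ℂ) ^ (-s0 D)

/-- `X₂(x, ψ) = ∑_{n ≤ x} υ₂₀(n) ψ(n) n^{-s₀}`. -/
def X2 (D : ℕ) (χ : DirichletCharacter ℂ D) {p : ℕ} (ψ : DirichletCharacter ℂ p) (x : ℝ) : ℂ :=
  ∑ n ∈ Finset.Icc 1 ⌊x⌋₊, ups20 D χ n * ψ (n : ZMod p) * (n : ℂ) ^ (-s0 D)

/-- `X₃(x, ψ) = ∑_{D⁴ < n ≤ x} ν(n) ψ(n) n^{-s₀}`. -/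
def X3 (D : ℕ) (χ : DirichletCharacter ℂ D) {p : ℕ} (ψ : DirichletCharacter ℂ p) (x : ℝ) : ℂ :=
  ∑ n ∈ Finset.Ioc (D ^ 4) ⌊x⌋₊, nuF D χ n * ψ (n : ZMod p) * (n : ℂ) ^ (-s0 D)

/-- `X₄(x, ψ) = ∑_{D⁴ < n ≤ x} ς(n) ψ(n) n^{-s₀}`. -/
def X4 (D : ℕ) (χ : DirichletCharacter ℂ D) {p : ℕ} (ψ : DirichletCharacter ℂ p) (x : ℝ) : ℂ :=
  ∑ n ∈ Finset.Ioc (D ^ 4) ⌊x⌋₊, sigF D χ n * ψ (n : ZMod p) * (n : ℂ) ^ (-s0 D)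

/-- Inequality (3.4). -/
def Ineq1 (D : ℕ) (χ : DirichletCharacter ℂ D) {p : ℕ} (ψ : DirichletCharacter ℂ p) : Prop :=
  ‖X1 D χ ψ ((D : ℝ) ^ 80)‖ + ‖X2 D χ ψ ((D : ℝ) ^ 80)‖ +
      (∫ x in (1 : ℝ)..((D : ℝ) ^ 80), (‖X1 D χ ψ x‖ + ‖X2 D χ ψ x‖) / x) <
    bigL D ^ 1171

/-- Inequality (3.5). -/
def Ineq2 (D : ℕ) (χ : DirichletCharacter ℂ D) {p : ℕ} (ψ : DirichletCharacter ℂ p) : Prop :=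
  ‖X3 D χ ψ (bigP D ^ 2)‖ + (∫ x in ((D : ℝ) ^ 4)..(bigP D ^ 2), ‖X3 D χ ψ x‖ / x) <
    bigL D ^ (-585 : ℤ)

/-- Inequality (3.6). -/
def Ineq3 (D : ℕ) (χ : DirichletCharacter ℂ D) {p : ℕ} (ψ : DirichletCharacter ℂ p) : Prop :=
  ‖X4 D χ ψ ((D : ℝ) ^ 8)‖ + (∫ x in ((D : ℝ) ^ 4)..((D : ℝ) ^ 8), ‖X4 D χ ψ x‖ / x) <
    bigL D ^ (-633 : ℤ)

/-- Membership in `Ψ₁`: `ψ` is a primitive character mod `p` with `p ~ P` satisfying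
(3.4), (3.5) and (3.6). -/
def MemPsi1 (D : ℕ) (χ : DirichletCharacter ℂ D) {p : ℕ} (ψ : DirichletCharacter ℂ p) : Prop :=
  SimP D p ∧ ψ.IsPrimitive ∧ Ineq1 D χ ψ ∧ Ineq2 D χ ψ ∧ Ineq3 D χ ψ

/-- `F(s, ψ) = ∑_{n ≤ D⁴} ν(n) ψ(n) n^{-s}`. -/
def Ffun (D : ℕ) (χ : DirichletCharacter ℂ D) {p : ℕ} (ψ : DirichletCharacter ℂ p) (s : ℂ) : ℂ :=
  ∑ n ∈ Finset.Icc 1 (D ^ 4), nuF D χ n * ψ (n : ZMod p) * (n : ℂ) ^ (-s)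

/-- `G(s, ψ) = ∑_{n ≤ D⁴} υ(n) ψ(n) n^{-s}`. -/
def Gfun (D : ℕ) (χ : DirichletCharacter ℂ D) {p : ℕ} (ψ : DirichletCharacter ℂ p) (s : ℂ) : ℂ :=
  ∑ n ∈ Finset.Icc 1 (D ^ 4), upsF D χ n * ψ (n : ZMod p) * (n : ℂ) ^ (-s)

/-- `F'(s, ψ) = -∑_{n ≤ D⁴} ν(n) ψ(n) (log n) n^{-s}`, the derivative of `F` in `s`. -/
def Ffun' (D : ℕ) (χ : DirichletCharacter ℂ D) {p : ℕ} (ψ : DirichletCharacter ℂ p) (s : ℂ) : ℂ :=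
  -∑ n ∈ Finset.Icc 1 (D ^ 4),
    nuF D χ n * ψ (n : ZMod p) * ((Real.log n : ℝ) : ℂ) * (n : ℂ) ^ (-s)

/-- `F(1 - s, ψ̄) = ∑_{n ≤ D⁴} ν(n) conj(ψ(n)) n^{s - 1}`, as a function of `s`. -/
def FfunBar (D : ℕ) (χ : DirichletCharacter ℂ D) {p : ℕ} (ψ : DirichletCharacter ℂ p)
    (s : ℂ) : ℂ :=
  ∑ n ∈ Finset.Icc 1 (D ^ 4),
    nuF D χ n * (starRingEnd ℂ) (ψ (n : ZMod p)) * (n : ℂ) ^ (s - 1)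

/-- The region `Ω`. -/
def InOmega (D : ℕ) (s : ℂ) : Prop :=
  |(s - s0 D).re| < 1 / 2 ∧ |(s - s0 D).im| < bigL1 D + 2

/-- The region `Ω₁`. -/
def InOmega1 (D : ℕ) (s : ℂ) : Prop :=
  1 / 2 - Real.log (bigL D) / (100 * bigL D) < s.re ∧
    s.re < 1 + Real.log (bigL D) / (100 * bigL D) ∧
    |s.im - 2 * Real.pi * t0 D| < bigL1 D + 5

/-- The region `Ω₂`. -/
def InOmega2 (D : ℕ) (s : ℂ) : Prop :=
  1 / 2 - (bigL D)⁻¹ < s.re ∧ s.re < 1 + (bigL D)⁻¹ ∧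
    |s.im - 2 * Real.pi * t0 D| < bigL1 D + 4

/-- `α = π / log P`. -/
def alphaD (D : ℕ) : ℝ := Real.pi / Real.log (bigP D)

/-- The region `Ω₃`. -/
def InOmega3 (D : ℕ) (s : ℂ) : Prop :=
  1 / 2 - alphaD D < s.re ∧ s.re < 1 + alphaD D ∧
    |s.im - 2 * Real.pi * t0 D| < bigL1 D + 3

/-- The Gauss sum `τ(θ) = ∑_{a mod k} θ(a) e(a/k)`. -/
def tauSum {k : ℕ} (θ : DirichletCharacter ℂ k) : ℂ :=
  ∑ a ∈ Finset.range k,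
    θ (a : ZMod k) * Complex.exp (2 * (Real.pi : ℂ) * Complex.I * (a : ℂ) / (k : ℂ))

/-- The factor `Z(s, θ)` from the functional equation. -/
def Zfun {k : ℕ} (θ : DirichletCharacter ℂ k) (s : ℂ) : ℂ :=
  if θ (-1) = 1 then
    tauSum θ * (Real.pi : ℂ) ^ (s - 1 / 2) * (k : ℂ) ^ (-s) *
      Complex.Gamma ((1 - s) / 2) / Complex.Gamma (s / 2)
  else
    -Complex.I * tauSum θ * (Real.pi : ℂ) ^ (s - 1 / 2) * (k : ℂ) ^ (-s) *
      Complex.Gamma ((2 - s) / 2) / Complex.Gamma ((1 + s) / 2)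

/-- The product character `χψ` modulo `D * p`, i.e. `n ↦ χ(n) ψ(n)`. -/
def chiPsi (D : ℕ) (χ : DirichletCharacter ℂ D) {p : ℕ} (ψ : DirichletCharacter ℂ p) :
    DirichletCharacter ℂ (D * p) :=
  DirichletCharacter.changeLevel (dvd_mul_right D p) χ *
    DirichletCharacter.changeLevel (dvd_mul_left p D) ψ

/-- `Z̃(s, ψ) = Z(s, ψ) Z(s, χψ)`. -/
def Ztilde (D : ℕ) (χ : DirichletCharacter ℂ D) {p : ℕ} (ψ : DirichletCharacter ℂ p)
    (s : ℂ) : ℂ :=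
  Zfun ψ s * Zfun (chiPsi D χ ψ) s

/-- `T = exp (𝓛 ^ 1.1)`. -/
def bigT (D : ℕ) : ℝ := Real.exp (bigL D ^ (1.1 : ℝ))

/-- `P₄ = P T⁻² t₀`. -/
def P4 (D : ℕ) : ℝ := bigP D * bigT D ^ (-2 : ℤ) * t0 D

/-- The smooth weight `g(x) = π^{-1/2} ∫_{-∞}^{𝓛^{15} log x} e^{-u²} du`. -/
def gfun (D : ℕ) (x : ℝ) : ℝ :=
  Real.pi ^ (-(1 : ℝ) / 2) * ∫ u in Set.Iio (bigL D ^ 15 * Real.log x), Real.exp (-u ^ 2)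

/-- `g*(y) = g(y)` for `y > 1/2`, and `0` otherwise. -/
def gstar (D : ℕ) (y : ℝ) : ℝ := if 1 / 2 < y then gfun D y else 0

/-- `K(s, ψ) = ∑_n ψ(n) n^{-s} g*(P₄ / n)`. -/
def Kfun (D : ℕ) {p : ℕ} (ψ : DirichletCharacter ℂ p) (s : ℂ) : ℂ :=
  ∑' n : ℕ, ψ (n : ZMod p) * (n : ℂ) ^ (-s) * ((gstar D (P4 D / n) : ℝ) : ℂ)

/-- `N(1 - s, ψ̄) = ∑_n conj(ψ(n)) n^{s-1} g*(T² / n)`, as a function of `s`. -/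
def Nfun (D : ℕ) {p : ℕ} (ψ : DirichletCharacter ℂ p) (s : ℂ) : ℂ :=
  ∑' n : ℕ,
    (starRingEnd ℂ) (ψ (n : ZMod p)) * (n : ℂ) ^ (s - 1) * ((gstar D (bigT D ^ 2 / n) : ℝ) : ℂ)

/-- `𝔞 = (6/π²) L'(1,χ)² ∏_{q ∣ D} q/(q+1)`. -/
def fraka (D : ℕ) (χ : DirichletCharacter ℂ D) : ℂ :=
  6 / (Real.pi : ℂ) ^ 2 * deriv (Lfun χ) 1 ^ 2 * ∏ q ∈ D.primeFactors, (q : ℂ) / ((q : ℂ) + 1)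

/-! ## Real characters and the Pólya–Vinogradov inequality -/

lemma realChar_cases {N : ℕ} {χ : DirichletCharacter ℂ N} (h : IsRealChar χ) (a : ZMod N) :
    χ a = 0 ∨ χ a = 1 ∨ χ a = -1 := by
  by_cases ha : IsUnit a
  · right
    have h1 : ‖χ a‖ = 1 := by
      obtain ⟨u, rfl⟩ := ha
      exact χ.unit_norm_eq_one u
    have h2 : χ a = ((χ a).re : ℂ) := by
      apply Complex.ext <;> simp [h a]
    have h3 : |(χ a).re| = 1 := by
      rw [h2, Complex.norm_real] at h1
      simpa using h1
    rcases eq_or_eq_neg_of_abs_eq h3 with h4 | h4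
    · left; rw [h2, h4]; simp
    · right; rw [h2, h4]; simp
  · left; exact χ.map_nonunit ha

lemma realChar_inv {N : ℕ} {χ : DirichletCharacter ℂ N} (h : IsRealChar χ) : χ⁻¹ = χ := by
  ext u
  rw [MulChar.inv_apply_eq_inv']
  rcases realChar_cases h (u : ZMod N) with h1 | h1 | h1 <;> rw [h1] <;> norm_num

lemma prim_ne_one {N : ℕ} (hN : 1 < N) {χ : DirichletCharacter ℂ N} (h : χ.IsPrimitive) :
    χ ≠ 1 := by
  rintro rfl
  have : NeZero N := ⟨by omega⟩
  rw [DirichletCharacter.isPrimitive_def, DirichletCharacter.conductor_one] at h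
  · omega

lemma dft_real {N : ℕ} [NeZero N] {χ : DirichletCharacter ℂ N} (h : IsRealChar χ)
    (hp : χ.IsPrimitive) (k : ZMod N) :
    ∑ j : ZMod N, ZMod.stdAddChar (-(j * k)) * χ j
      = (χ (-1) * gaussSum χ ZMod.stdAddChar) * χ k := by
  have h1 := hp.fourierTransform_eq_inv_mul_gaussSum k
  rw [ZMod.dft_apply, realChar_inv h] at h1
  simp only [smul_eq_mul] at h1
  rw [h1, ← neg_one_mul k, map_mul]
  ring

lemma gauss_norm {N : ℕ} [NeZero N] {χ : DirichletCharacter ℂ N} (h : IsRealChar χ)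
    (hp : χ.IsPrimitive) : ‖χ (-1) * gaussSum χ ZMod.stdAddChar‖ = Real.sqrt N := by
  set c := χ (-1) * gaussSum χ ZMod.stdAddChar with hc
  have h2 : ZMod.dft (fun j : ZMod N => χ j) = fun k => c * χ k := by
    ext k
    rw [ZMod.dft_apply, ← dft_real h hp k]
    simp
  have h3 := ZMod.dft_dft (fun j : ZMod N => χ j)
  rw [h2, ZMod.dft_const_mul, h2] at h3
  have h4 := congrFun h3 1
  simp only [smul_eq_mul, map_one, mul_one] at h4
  have h5 : ‖χ (-1 : ZMod N)‖ = 1 := by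
    have := χ.unit_norm_eq_one (-1 : (ZMod N)ˣ)
    simpa using this
  have h6 : ‖c‖ * ‖c‖ = N := by
    rw [← norm_mul, h4, norm_mul, h5, mul_one, Complex.norm_natCast]
  rw [← h6, Real.sqrt_mul_self (norm_nonneg _)]

lemma geom_norm_le (w : ℂ) (hw : ‖w‖ = 1) (h1 : w ≠ 1) (N : ℕ) :
    ‖∑ k ∈ Finset.range N, w ^ k‖ ≤ 2 / ‖w - 1‖ := by
  have : w - 1 ≠ 0 := sub_ne_zero.mpr h1
  rw [geom_sum_eq h1, norm_div]
  gcongr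
  calc ‖w ^ N - 1‖ ≤ ‖w ^ N‖ + ‖(1:ℂ)‖ := norm_sub_le _ _
    _ = 2 := by rw [norm_pow, hw]; norm_num

lemma sin_pi_lower {t : ℝ} (h0 : 0 ≤ t) (h1 : t ≤ 1) : 2 * t * (1 - t) ≤ Real.sin (Real.pi * t) := by
  have hpi := Real.pi_pos
  rcases le_total t (1/2) with h | h
  · have := Real.mul_le_sin (x := Real.pi * t) (by positivity) (by nlinarith)
    have h2 : 2 / Real.pi * (Real.pi * t) = 2 * t := by field_simp
    nlinarith
  · have := Real.mul_le_sin (x := Real.pi * (1 - t)) (mul_nonneg hpi.le (by linarith)) (by nlinarith)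
    have h2 : 2 / Real.pi * (Real.pi * (1 - t)) = 2 * (1 - t) := by field_simp
    have h3 : Real.sin (Real.pi * (1 - t)) = Real.sin (Real.pi * t) := by
      rw [mul_sub, mul_one, Real.sin_pi_sub]
    rw [h2, h3] at this
    nlinarith

lemma stdAdd_norm_lower {N : ℕ} [NeZero N] (j : ZMod N) :
    4 * ((j.val : ℝ) / N) * (1 - (j.val : ℝ) / N) ≤ ‖(ZMod.stdAddChar (-j) : ℂ) - 1‖ := by
  have hN : (0:ℝ) < N := by exact_mod_cast Nat.pos_of_ne_zero (NeZero.ne N)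
  have hlt : (j.val : ℝ) < N := by exact_mod_cast ZMod.val_lt j
  have e1 : (ZMod.stdAddChar (-j) : ℂ) = Complex.exp (Complex.I * ((-(2 * Real.pi * (j.val / N)) : ℝ))) := by
    have : (-j : ZMod N) = ((-(j.val : ℤ) : ℤ) : ZMod N) := by simp
    rw [this, ZMod.stdAddChar_coe]
    congr 1
    push_cast
    ring
  rw [e1, Complex.norm_exp_I_mul_ofReal_sub_one]
  have e2 : -(2 * Real.pi * (j.val / N)) / 2 = -(Real.pi * ((j.val : ℝ) / N)) := by ring
  rw [e2, Real.sin_neg, Real.norm_eq_abs, abs_mul, abs_neg]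
  have := sin_pi_lower (t := (j.val : ℝ) / N) (by positivity) (by rw [div_le_one hN]; exact hlt.le)
  have h3 := le_abs_self (Real.sin (Real.pi * ((j.val : ℝ) / N)))
  rw [abs_of_pos (by norm_num : (0:ℝ) < 2)]
  linarith

lemma harmonic_real_le (n : ℕ) :
    ∑ k ∈ Finset.Icc 1 n, (1 : ℝ) / k ≤ 1 + Real.log n := by
  have := harmonic_le_one_add_log n
  rw [harmonic_eq_sum_Icc] at this
  push_cast at this
  simpa using this

lemma polya_vinogradov {N : ℕ} (hN : 1 < N) {χ : DirichletCharacter ℂ N} (h : IsRealChar χ)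
    (hp : χ.IsPrimitive) (K : ℕ) :
    ‖∑ k ∈ Finset.range K, χ (k : ZMod N)‖ ≤ Real.sqrt N * (1 + Real.log N) := by
  have : NeZero N := ⟨by omega⟩
  have : Fact (1 < N) := ⟨hN⟩
  have hN0 : (0:ℝ) < N := by positivity
  set c := χ (-1) * gaussSum χ ZMod.stdAddChar with hc
  have hcn : ‖c‖ = Real.sqrt N := gauss_norm h hp
  have key : c * ∑ k ∈ Finset.range K, χ (k : ZMod N)
      = ∑ j : ZMod N, χ j * ∑ k ∈ Finset.range K, (ZMod.stdAddChar (-j) : ℂ) ^ k := by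
    have hk : ∀ k : ZMod N, c * χ k = ∑ j : ZMod N, ZMod.stdAddChar (-(j * k)) * χ j :=
      fun k => (dft_real h hp k).symm
    rw [Finset.mul_sum]
    simp_rw [hk, Finset.mul_sum]
    rw [Finset.sum_comm]
    refine Finset.sum_congr rfl fun j _ => Finset.sum_congr rfl fun k _ => ?_
    rw [mul_comm, ← AddChar.map_nsmul_eq_pow]
    congr 2
    simp [mul_comm]
  have bound : ∀ j : ZMod N, ‖χ j * ∑ k ∈ Finset.range K, (ZMod.stdAddChar (-j) : ℂ) ^ k‖
      ≤ N / 2 * (1 / (j.val : ℝ) + 1 / ((N : ℝ) - j.val)) := by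
    intro j
    have hlt : (j.val : ℝ) < N := by exact_mod_cast ZMod.val_lt j
    by_cases hj : j = 0
    · subst hj
      rw [MulChar.map_zero]
      simp only [zero_mul, norm_zero, ZMod.val_zero, Nat.cast_zero, div_zero, sub_zero, zero_add]
      positivity
    have hv : (0:ℝ) < j.val := by
      have : j.val ≠ 0 := by rwa [Ne, ZMod.val_eq_zero]
      positivity
    have hlow := stdAdd_norm_lower j
    have hpos : 0 < 4 * ((j.val : ℝ) / N) * (1 - (j.val : ℝ) / N) := by
      have : (j.val : ℝ) / N < 1 := by rwa [div_lt_one hN0]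
      have : 0 < 1 - (j.val : ℝ) / N := by linarith
      positivity
    have hw1 : (ZMod.stdAddChar (-j) : ℂ) ≠ 1 := by
      intro hh
      rw [hh, sub_self, norm_zero] at hlow; linarith
    rw [norm_mul]
    have h1 : ‖χ j‖ ≤ 1 := χ.norm_le_one j
    have h2 := geom_norm_le (ZMod.stdAddChar (-j) : ℂ) (by simp) hw1 K
    have hd : (N:ℝ) - j.val ≠ 0 := by linarith
    calc ‖χ j‖ * ‖∑ k ∈ Finset.range K, (ZMod.stdAddChar (-j) : ℂ) ^ k‖
        ≤ 1 * (2 / ‖(ZMod.stdAddChar (-j) : ℂ) - 1‖) := by gcongr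
      _ ≤ 1 * (2 / (4 * ((j.val : ℝ) / N) * (1 - (j.val : ℝ) / N))) := by gcongr
      _ = N / 2 * (1 / (j.val : ℝ) + 1 / ((N : ℝ) - j.val)) := by
          field_simp
          ring
  have tot : ∑ j : ZMod N, (N:ℝ) / 2 * (1 / (j.val : ℝ) + 1 / ((N : ℝ) - j.val))
      ≤ N * (1 + Real.log N) := by
    have e : ∑ j : ZMod N, (N:ℝ) / 2 * (1 / (j.val : ℝ) + 1 / ((N : ℝ) - j.val))
        = ∑ j ∈ Finset.range N, (N:ℝ) / 2 * (1 / (j : ℝ) + 1 / ((N : ℝ) - j)) := by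
      obtain ⟨n, rfl⟩ : ∃ n, N = n + 1 := ⟨N - 1, by omega⟩
      exact Fin.sum_univ_eq_sum_range
        (fun j => ((n+1:ℕ):ℝ) / 2 * (1 / (j : ℝ) + 1 / (((n+1:ℕ) : ℝ) - j))) (n+1)
    rw [e, ← Finset.mul_sum, Finset.sum_add_distrib]
    have hH := harmonic_real_le N
    have a1 : ∑ j ∈ Finset.range N, 1 / (j : ℝ) ≤ ∑ k ∈ Finset.Icc 1 N, (1 : ℝ) / k := by
      have : ∑ j ∈ Finset.range (N+1), 1 / (j : ℝ) = ∑ k ∈ Finset.Icc 1 N, (1 : ℝ) / k := by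
        rw [Finset.sum_range_eq_add_Ico _ (by omega)]
        simp
        rfl
      rw [← this]
      exact Finset.sum_le_sum_of_subset_of_nonneg (by simp) (fun _ _ _ => by positivity)
    have a2 : ∑ j ∈ Finset.range N, 1 / ((N : ℝ) - j) = ∑ k ∈ Finset.Icc 1 N, (1 : ℝ) / k := by
      refine Finset.sum_bij' (fun j _ => N - j) (fun k _ => N - k) ?_ ?_ ?_ ?_ ?_
      · intro j hj; simp at hj ⊢; omega
      · intro j hj; simp at hj ⊢; omega
      · intro j hj; simp at hj ⊢; omega
      · intro j hj; simp at hj ⊢; omega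
      · intro j hj; simp at hj; rw [Nat.cast_sub hj.le]
    rw [a2]
    nlinarith
  have fin : Real.sqrt N * ‖∑ k ∈ Finset.range K, χ (k : ZMod N)‖ ≤ N * (1 + Real.log N) := by
    rw [← hcn, ← norm_mul, key]
    exact (norm_sum_le _ _).trans ((Finset.sum_le_sum fun j _ => bound j).trans tot)
  have hs : 0 < Real.sqrt N := Real.sqrt_pos.mpr hN0
  have : Real.sqrt N * ‖∑ k ∈ Finset.range K, χ (k : ZMod N)‖
      ≤ Real.sqrt N * (Real.sqrt N * (1 + Real.log N)) := by
    rw [← mul_assoc, Real.mul_self_sqrt hN0.le]; exact fin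
  exact le_of_mul_le_mul_left this hs

/-! ## Partial summation, `L(1,χ)` and the summatory function of `ν` -/

lemma abel_bound (g : ℕ → ℂ) (f : ℕ → ℝ) (M : ℝ)
    (hM : ∀ K, ‖∑ k ∈ Finset.range K, g k‖ ≤ M) (a b : ℕ) (hab : a ≤ b)
    (hf : ∀ k, a ≤ k → f (k + 1) ≤ f k) (hf0 : ∀ k, a ≤ k → 0 ≤ f k) :
    ‖∑ k ∈ Finset.Ico a b, g k * (f k : ℂ)‖ ≤ 2 * M * f a := by
  set G : ℕ → ℂ := fun K => ∑ k ∈ Finset.range K, g k with hG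
  have hg : ∀ k, g k = G (k + 1) - G k := by
    intro k; simp [hG, Finset.sum_range_succ]
  have id1 : ∀ b, a ≤ b → ∑ k ∈ Finset.Ico a b, g k * (f k : ℂ)
      = f b * G b - f a * G a + ∑ k ∈ Finset.Ico a b, ((f k - f (k+1) : ℝ) : ℂ) * G (k + 1) := by
    intro b hb
    induction b, hb using Nat.le_induction with
    | base => simp
    | succ b hb ih =>
      rw [Finset.sum_Ico_succ_top hb, Finset.sum_Ico_succ_top hb, ih, hg b]
      push_cast; ring
  have id2 : ∀ b, a ≤ b → ∑ k ∈ Finset.Ico a b, (f k - f (k+1)) = f a - f b := by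
    intro b hb
    induction b, hb using Nat.le_induction with
    | base => simp
    | succ b hb ih =>
      rw [Finset.sum_Ico_succ_top hb, ih]; ring
  rw [id1 b hab]
  have h1 : ‖∑ k ∈ Finset.Ico a b, ((f k - f (k+1) : ℝ) : ℂ) * G (k + 1)‖ ≤ (f a - f b) * M := by
    rw [← id2 b hab, Finset.sum_mul]
    refine (norm_sum_le _ _).trans (Finset.sum_le_sum fun k hk => ?_)
    have hk' := (Finset.mem_Ico.mp hk).1
    have := hf k hk'
    rw [norm_mul, Complex.norm_real, Real.norm_eq_abs, abs_of_nonneg (by linarith)]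
    exact mul_le_mul_of_nonneg_left (hM _) (by linarith)
  have h2 : ‖(f b : ℂ) * G b‖ ≤ f b * M := by
    rw [norm_mul, Complex.norm_real, Real.norm_eq_abs, abs_of_nonneg (hf0 b hab)]
    exact mul_le_mul_of_nonneg_left (hM _) (hf0 b hab)
  have h3 : ‖(f a : ℂ) * G a‖ ≤ f a * M := by
    rw [norm_mul, Complex.norm_real, Real.norm_eq_abs, abs_of_nonneg (hf0 a le_rfl)]
    exact mul_le_mul_of_nonneg_left (hM _) (hf0 a le_rfl)
  have := norm_add_le (f b * G b - f a * G a) (∑ k ∈ Finset.Ico a b, ((f k - f (k+1) : ℝ) : ℂ) * G (k + 1))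
  have h4 := norm_sub_le ((f b : ℂ) * G b) (f a * G a)
  linarith

lemma L_one_approx {N : ℕ} [NeZero N] {χ : DirichletCharacter ℂ N} (hχ : χ ≠ 1)
    (M : ℝ) (hM : ∀ K, ‖∑ k ∈ Finset.range K, χ (k : ZMod N)‖ ≤ M) (z : ℕ) (hz : 1 ≤ z) :
    ‖DirichletCharacter.LFunction χ 1 - ∑ a ∈ Finset.Ico 1 z, χ (a : ZMod N) * ((1 / (a:ℝ) : ℝ) : ℂ)‖
      ≤ 2 * M / z := by
  have hM0 : 0 ≤ M := (norm_nonneg _).trans (hM 0)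
  have hz0 : (0:ℝ) < z := by exact_mod_cast hz
  have step : ∀ s : ℝ, 1 < s →
      ‖DirichletCharacter.LFunction χ s
        - ∑ a ∈ Finset.Ico 1 z, χ (a : ZMod N) * (((a:ℝ) ^ (-s) : ℝ) : ℂ)‖ ≤ 2 * M / z := by
    intro s hs
    have hs' : 1 < (s:ℂ).re := by simpa using hs
    rw [DirichletCharacter.LFunction_eq_LSeries χ hs']
    have hsum := (DirichletCharacter.LSeriesSummable_of_one_lt_re χ hs').hasSum.tendsto_sum_nat
    have hterm : ∀ n : ℕ, LSeries.term (fun n => χ (n : ZMod N)) s n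
        = if n = 0 then 0 else χ (n : ZMod N) * (((n:ℝ) ^ (-s) : ℝ) : ℂ) := by
      intro n
      rw [LSeries.term_def]
      split_ifs with h
      · rfl
      · rw [Complex.ofReal_cpow (by positivity)]
        push_cast
        rw [Complex.cpow_neg, div_eq_mul_inv]
    have hr : ∀ b, 1 ≤ b → ∑ n ∈ Finset.range b, LSeries.term (fun n => χ (n : ZMod N)) s n
        = ∑ a ∈ Finset.Ico 1 b, χ (a : ZMod N) * (((a:ℝ) ^ (-s) : ℝ) : ℂ) := by
      intro b hb
      rw [Finset.sum_range_eq_add_Ico _ (by omega), hterm 0]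
      simp only [if_true, zero_add]
      refine Finset.sum_congr rfl fun a ha => ?_
      rw [hterm a, if_neg (by have := (Finset.mem_Ico.mp ha).1; omega)]
    have hl : Filter.Tendsto (fun b => ‖∑ n ∈ Finset.range b, LSeries.term (fun n => χ (n : ZMod N)) s n
        - ∑ a ∈ Finset.Ico 1 z, χ (a : ZMod N) * (((a:ℝ) ^ (-s) : ℝ) : ℂ)‖) Filter.atTop
        (nhds ‖LSeries (fun n => χ (n : ZMod N)) s
        - ∑ a ∈ Finset.Ico 1 z, χ (a : ZMod N) * (((a:ℝ) ^ (-s) : ℝ) : ℂ)‖) :=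
      (hsum.sub_const _).norm
    refine le_of_tendsto hl ?_
    filter_upwards [Filter.eventually_ge_atTop z] with b hb
    rw [hr b (hz.trans hb), ← Finset.sum_Ico_consecutive _ hz hb, add_sub_cancel_left]
    refine (abel_bound _ (fun k => (k:ℝ) ^ (-s)) M hM z b hb ?_ ?_).trans ?_
    · intro k hk
      have : (0:ℝ) < k := by exact_mod_cast (by omega : 0 < k)
      exact Real.rpow_le_rpow_of_nonpos this (by push_cast; linarith) (by linarith)
    · intro k _; positivity
    · have : (z:ℝ) ^ (-s) ≤ (z:ℝ) ^ (-1:ℝ) :=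
        Real.rpow_le_rpow_of_exponent_le (by exact_mod_cast hz) (by linarith)
      rw [Real.rpow_neg_one] at this
      rw [div_eq_mul_inv]
      gcongr
  have hc : Filter.Tendsto (fun s : ℝ => ‖DirichletCharacter.LFunction χ s
        - ∑ a ∈ Finset.Ico 1 z, χ (a : ZMod N) * (((a:ℝ) ^ (-s) : ℝ) : ℂ)‖) (nhdsWithin 1 (Set.Ioi 1))
        (nhds ‖DirichletCharacter.LFunction χ (1:ℝ)
        - ∑ a ∈ Finset.Ico 1 z, χ (a : ZMod N) * (((a:ℝ) ^ (-1:ℝ) : ℝ) : ℂ)‖) := by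
    apply Filter.Tendsto.mono_left _ nhdsWithin_le_nhds
    have hd := (DirichletCharacter.differentiable_LFunction hχ).continuous
    apply ContinuousAt.tendsto (f := fun s : ℝ => ‖DirichletCharacter.LFunction χ s
        - ∑ a ∈ Finset.Ico 1 z, χ (a : ZMod N) * (((a:ℝ) ^ (-s) : ℝ) : ℂ)‖)
    apply ContinuousAt.norm
    apply ContinuousAt.sub
    · exact (hd.comp Complex.continuous_ofReal).continuousAt
    · apply tendsto_finsetSum
      intro a ha
      have ha' : (a:ℝ) ≠ 0 := by
        have := (Finset.mem_Ico.mp ha).1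
        exact_mod_cast (by omega : a ≠ 0)
      apply Filter.Tendsto.mul tendsto_const_nhds
      apply (Complex.continuous_ofReal.tendsto _).comp
      exact (Real.continuousAt_const_rpow ha').comp_of_eq continuous_neg.continuousAt rfl
  have := le_of_tendsto hc (by
    filter_upwards [self_mem_nhdsWithin] with s hs using step s hs)
  simpa [Real.rpow_neg_one] using this

/-- The real character as an arithmetic function. -/
def chiA {D : ℕ} (χ : DirichletCharacter ℂ D) : ArithmeticFunction ℝ :=
  ⟨fun n => if n = 0 then 0 else (χ (n : ZMod D)).re, by simp⟩

/-- `ν` as a real arithmetic function. -/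
def nuA {D : ℕ} (χ : DirichletCharacter ℂ D) : ArithmeticFunction ℝ :=
  chiA χ * (ArithmeticFunction.zeta : ArithmeticFunction ℝ)

lemma nu_summatory {D : ℕ} (hD : 1 < D) {χ : DirichletCharacter ℂ D} (hp : χ.IsPrimitive)
    (M : ℝ) (hM : ∀ K, ‖∑ k ∈ Finset.range K, χ (k : ZMod D)‖ ≤ M) (z y : ℕ) (hz : 1 ≤ z)
    (hzy : z ≤ y) :
    ∑ n ∈ Finset.Ioc 0 y, nuA χ n ≤ y * (Lfun χ 1).re + z + 4 * M * y / z := by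
  have : NeZero D := ⟨by omega⟩
  have hM0 : 0 ≤ M := (norm_nonneg _).trans (hM 0)
  have hz0 : (0:ℝ) < z := by exact_mod_cast hz
  have hL := L_one_approx (prim_ne_one hD hp) M hM z hz
  have hLf : Lfun χ 1 = DirichletCharacter.LFunction χ 1 := by
    unfold Lfun; rw [dif_neg (by omega)]
  rw [← hLf] at hL
  unfold nuA
  rw [ArithmeticFunction.sum_Ioc_mul_zeta_eq_sum]
  have e1 : ∑ n ∈ Finset.Ioc 0 y, chiA χ n * ((y / n : ℕ) : ℝ)
      = (∑ n ∈ Finset.Ico 1 (y+1), χ (n : ZMod D) * (((y / n : ℕ) : ℝ) : ℂ)).re := by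
    rw [Complex.re_sum]
    refine Finset.sum_congr (by ext; simp; omega) fun n hn => ?_
    have : n ≠ 0 := by have := (Finset.mem_Ico.mp hn).1; omega
    rw [Complex.re_mul_ofReal]
    simp [chiA, this]
  rw [e1, ← Finset.sum_Ico_consecutive _ hz (by omega : z ≤ y + 1), Complex.add_re]
  have h2 := abel_bound (fun k => χ (k : ZMod D)) (fun n => ((y / n : ℕ) : ℝ)) M hM z (y+1) (by omega)
    (fun k hk => by
      have : y / (k+1) ≤ y / k := Nat.div_le_div_left (by omega) (by omega)
      exact_mod_cast this) (fun k _ => by positivity)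
  have h2' : 2 * M * ((y / z : ℕ) : ℝ) ≤ 2 * M * (y / z) := by
    gcongr
    exact Nat.cast_div_le
  have h2r := (Complex.re_le_norm _).trans (h2.trans h2')
  set A := ∑ a ∈ Finset.Ico 1 z, χ (a : ZMod D) * ((1 / (a:ℝ) : ℝ) : ℂ) with hA
  have hLr : A.re ≤ (Lfun χ 1).re + 2 * M / z := by
    have := (Complex.abs_re_le_norm (Lfun χ 1 - A)).trans hL
    rw [Complex.sub_re] at this
    linarith [(abs_le.mp this).1]
  have h3 : (∑ n ∈ Finset.Ico 1 z, χ (n : ZMod D) * (((y / n : ℕ) : ℝ) : ℂ)).re ≤ y * A.re + z := by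
    have e : (∑ n ∈ Finset.Ico 1 z, χ (n : ZMod D) * (((y / n : ℕ) : ℝ) : ℂ)).re - y * A.re
        = ∑ n ∈ Finset.Ico 1 z, (χ (n : ZMod D)).re * (((y / n : ℕ) : ℝ) - y / n) := by
      rw [hA, Complex.re_sum, Complex.re_sum, Finset.mul_sum, ← Finset.sum_sub_distrib]
      refine Finset.sum_congr rfl fun n _ => ?_
      rw [Complex.re_mul_ofReal, Complex.re_mul_ofReal]
      ring
    have b : ∑ n ∈ Finset.Ico 1 z, (χ (n : ZMod D)).re * (((y / n : ℕ) : ℝ) - y / n)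
        ≤ ∑ n ∈ Finset.Ico 1 z, (1:ℝ) := by
      refine Finset.sum_le_sum fun n hn => ?_
      have hn0 : 0 < n := by have := (Finset.mem_Ico.mp hn).1; omega
      have a1 : |(χ (n : ZMod D)).re| ≤ 1 := (Complex.abs_re_le_norm _).trans (χ.norm_le_one _)
      have a2 : ((y / n : ℕ) : ℝ) ≤ y / n := Nat.cast_div_le
      have a3 : (y:ℝ) / n < ((y / n : ℕ) : ℝ) + 1 := by
        rw [div_lt_iff₀ (by exact_mod_cast hn0)]
        have := Nat.lt_div_mul_add (a := y) hn0
        have h' : (y:ℝ) < ((y/n * n + n : ℕ) : ℝ) := by exact_mod_cast this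
        push_cast at h'
        linarith
      have a4 := abs_le.mp a1
      nlinarith
    have b2 : ∑ n ∈ Finset.Ico 1 z, (1:ℝ) ≤ z := by
      simp
    linarith
  have h4 : (y:ℝ) * A.re ≤ y * ((Lfun χ 1).re + 2 * M / z) := by gcongr
  have e5 : 4 * M * y / z = y * (2 * M / z) + 2 * M * (y / z) := by ring
  rw [e5]
  linarith

/-! ## Multiplicative inequalities -/

lemma chiA_mult {D : ℕ} {χ : DirichletCharacter ℂ D} (h : IsRealChar χ) :
    (chiA χ).IsMultiplicative := by
  rw [ArithmeticFunction.IsMultiplicative.iff_ne_zero]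
  refine ⟨by simp [chiA], fun {m n} hm hn _ => ?_⟩
  simp [chiA, hm, hn]
  exact Or.inl (h _)

lemma chiA_mul {D : ℕ} {χ : DirichletCharacter ℂ D} (h : IsRealChar χ) (m n : ℕ) :
    chiA χ (m * n) = chiA χ m * chiA χ n := by
  by_cases hm : m = 0
  · simp [chiA, hm]
  by_cases hn : n = 0
  · simp [chiA, hn]
  simp [chiA, hm, hn]
  exact Or.inl (h _)

lemma chiA_pow {D : ℕ} {χ : DirichletCharacter ℂ D} (h : IsRealChar χ) (q k : ℕ) :
    chiA χ (q ^ k) = chiA χ q ^ k := by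
  induction k with
  | zero => simp [(chiA_mult h).map_one]
  | succ k ih => rw [pow_succ, chiA_mul h, ih, pow_succ]

lemma chiA_cases {D : ℕ} {χ : DirichletCharacter ℂ D} (h : IsRealChar χ) (q : ℕ) :
    chiA χ q = 0 ∨ chiA χ q = 1 ∨ chiA χ q = -1 := by
  by_cases hq : q = 0
  · left; simp [chiA, hq]
  rcases realChar_cases h (q : ZMod D) with h1 | h1 | h1 <;> simp [chiA, hq, h1]

lemma nuA_mult {D : ℕ} {χ : DirichletCharacter ℂ D} (h : IsRealChar χ) :
    (nuA χ).IsMultiplicative :=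
  (chiA_mult h).mul ArithmeticFunction.isMultiplicative_zeta.natCast

lemma conv_pp (f g : ArithmeticFunction ℝ) {q : ℕ} (hq : q.Prime) (k : ℕ) :
    (f * g) (q ^ k) = ∑ i ∈ Finset.range (k + 1), f (q ^ i) * g (q ^ (k - i)) := by
  rw [ArithmeticFunction.mul_apply, Nat.sum_divisorsAntidiagonal (fun a b => f a * g b),
    Nat.sum_divisors_prime_pow hq]
  refine Finset.sum_congr rfl fun i hi => ?_
  rw [Nat.pow_div (by have := Finset.mem_range.mp hi; omega) hq.pos]

lemma mult_prod {f : ArithmeticFunction ℝ} (hf : f.IsMultiplicative) {n : ℕ} (hn : n ≠ 0)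
    (S : Finset ℕ) (hS : n.primeFactors ⊆ S) :
    f n = ∏ p ∈ S, f (p ^ n.factorization p) := by
  rw [hf.multiplicative_factorization f hn]
  apply Finsupp.prod_of_support_subset
  · simpa using hS
  · intro i _; simp [hf.map_one]

lemma nuA_pp {D : ℕ} {χ : DirichletCharacter ℂ D} (h : IsRealChar χ) {q : ℕ} (hq : q.Prime)
    (k : ℕ) : nuA χ (q ^ k) = ∑ j ∈ Finset.range (k + 1), chiA χ q ^ j := by
  unfold nuA
  rw [conv_pp _ _ hq]
  refine Finset.sum_congr rfl fun i _ => ?_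
  simp [chiA_pow h, ArithmeticFunction.natCoe_apply, ArithmeticFunction.zeta_apply, hq.ne_zero]

lemma nuA_pp_one {D : ℕ} {χ : DirichletCharacter ℂ D} (h : IsRealChar χ) {q : ℕ} (hq : q.Prime)
    (he : chiA χ q = 1) (k : ℕ) : nuA χ (q ^ k) = k + 1 := by
  rw [nuA_pp h hq, he]; simp

lemma nuA_pp_zero {D : ℕ} {χ : DirichletCharacter ℂ D} (h : IsRealChar χ) {q : ℕ} (hq : q.Prime)
    (he : chiA χ q = 0) (k : ℕ) : nuA χ (q ^ k) = 1 := by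
  rw [nuA_pp h hq, he, Finset.sum_range_succ']; simp

lemma nuA_pp_neg {D : ℕ} {χ : DirichletCharacter ℂ D} (h : IsRealChar χ) {q : ℕ} (hq : q.Prime)
    (he : chiA χ q = -1) (k : ℕ) : nuA χ (q ^ k) = if Even k then 1 else 0 := by
  rw [nuA_pp h hq, he, neg_one_geom_sum]
  by_cases hk : Even k <;> simp [hk, Nat.even_add_one]

/-- `ν * ν`. -/
def hA {D : ℕ} (χ : DirichletCharacter ℂ D) : ArithmeticFunction ℝ := nuA χ * nuA χ

lemma hA_mult {D : ℕ} {χ : DirichletCharacter ℂ D} (h : IsRealChar χ) :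
    (hA χ).IsMultiplicative := (nuA_mult h).mul (nuA_mult h)

lemma hA_pp_one {D : ℕ} {χ : DirichletCharacter ℂ D} (h : IsRealChar χ) {q : ℕ} (hq : q.Prime)
    (he : chiA χ q = 1) (k : ℕ) : hA χ (q ^ k) = (k + 1) * (k + 2) * (k + 3) / 6 := by
  unfold hA
  rw [conv_pp _ _ hq]
  have e : ∀ m : ℕ, ∀ K : ℝ, ∑ i ∈ Finset.range m, ((i:ℝ) + 1) * (K - i + 1)
      = m * (m + 1) * (3 * K + 5 - 2 * m) / 6 := by
    intro m K
    induction m with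
    | zero => simp
    | succ m ih => rw [Finset.sum_range_succ, ih]; push_cast; ring
  have e2 := e (k+1) k
  rw [Finset.sum_congr rfl (g := fun i : ℕ => ((i:ℝ) + 1) * ((k:ℝ) - i + 1)), e2]
  · push_cast; ring
  · intro i hi
    rw [nuA_pp_one h hq he, nuA_pp_one h hq he,
      Nat.cast_sub (by have := Finset.mem_range.mp hi; omega)]

lemma hA_pp_zero {D : ℕ} {χ : DirichletCharacter ℂ D} (h : IsRealChar χ) {q : ℕ} (hq : q.Prime)
    (he : chiA χ q = 0) (k : ℕ) : hA χ (q ^ k) = k + 1 := by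
  unfold hA
  rw [conv_pp _ _ hq]
  simp [nuA_pp_zero h hq he]

lemma hA_pp_neg_odd {D : ℕ} {χ : DirichletCharacter ℂ D} (h : IsRealChar χ) {q : ℕ} (hq : q.Prime)
    (he : chiA χ q = -1) (k : ℕ) (hk : ¬ Even k) : hA χ (q ^ k) = 0 := by
  unfold hA
  rw [conv_pp _ _ hq]
  refine Finset.sum_eq_zero fun i hi => ?_
  rw [nuA_pp_neg h hq he, nuA_pp_neg h hq he]
  have := Finset.mem_range.mp hi
  by_cases h1 : Even i <;> by_cases h2 : Even (k - i) <;> simp [h1, h2]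
  apply hk
  have : k = i + (k - i) := by omega
  rw [this]; exact h1.add h2

lemma hA_pp_neg_even {D : ℕ} {χ : DirichletCharacter ℂ D} (h : IsRealChar χ) {q : ℕ} (hq : q.Prime)
    (he : chiA χ q = -1) (k : ℕ) : hA χ (q ^ (k + k)) = k + 1 := by
  unfold hA
  rw [conv_pp _ _ hq]
  have e : ∀ m : ℕ, ∑ i ∈ Finset.range (m + m + 1), (if Even i then (1:ℝ) else 0) = m + 1 := by
    intro m
    induction m with
    | zero => simp [-Finset.sum_boole]
    | succ m ih =>
      rw [show m + 1 + (m + 1) + 1 = (m + m + 1) + 1 + 1 by ring, Finset.sum_range_succ,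
        Finset.sum_range_succ, ih]
      have : ¬ Even (m + m + 1) := by simp [Nat.even_add_one]
      rw [if_neg this, if_pos (by simp [Nat.even_add_one])]
      push_cast; ring
  rw [← e k]
  refine Finset.sum_congr rfl fun i hi => ?_
  have := Finset.mem_range.mp hi
  rw [nuA_pp_neg h hq he, nuA_pp_neg h hq he]
  have : Even (k + k - i) ↔ Even i := by
    rw [Nat.even_sub (by omega)]; simp
  by_cases h1 : Even i <;> simp [h1, this]

lemma nuA_pp_nonneg {D : ℕ} {χ : DirichletCharacter ℂ D} (h : IsRealChar χ) {q : ℕ} (hq : q.Prime)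
    (k : ℕ) : 0 ≤ nuA χ (q ^ k) := by
  rcases chiA_cases h q with he | he | he
  · rw [nuA_pp_zero h hq he]; norm_num
  · rw [nuA_pp_one h hq he]; positivity
  · rw [nuA_pp_neg h hq he]; split_ifs <;> norm_num

lemma hA_pp_nonneg {D : ℕ} {χ : DirichletCharacter ℂ D} (h : IsRealChar χ) {q : ℕ} (hq : q.Prime)
    (k : ℕ) : 0 ≤ hA χ (q ^ k) := by
  unfold hA
  rw [conv_pp _ _ hq]
  exact Finset.sum_nonneg fun i _ => mul_nonneg (nuA_pp_nonneg h hq _) (nuA_pp_nonneg h hq _)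

lemma nuA_nonneg {D : ℕ} {χ : DirichletCharacter ℂ D} (h : IsRealChar χ) (n : ℕ) :
    0 ≤ nuA χ n := by
  by_cases hn : n = 0
  · simp [hn]
  rw [mult_prod (nuA_mult h) hn _ (subset_refl _)]
  exact Finset.prod_nonneg fun p hp => nuA_pp_nonneg h (Nat.prime_of_mem_primeFactors hp) _

lemma hA_nonneg {D : ℕ} {χ : DirichletCharacter ℂ D} (h : IsRealChar χ) (n : ℕ) :
    0 ≤ hA χ n := by
  unfold hA
  rw [ArithmeticFunction.mul_apply]
  exact Finset.sum_nonneg fun i _ => mul_nonneg (nuA_nonneg h _) (nuA_nonneg h _)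

lemma pp_ineq6 {D : ℕ} {χ : DirichletCharacter ℂ D} (h : IsRealChar χ) {q : ℕ} (hq : q.Prime)
    (a b : ℕ) : nuA χ (q ^ (a + b)) * (nuA χ (q ^ a) * nuA χ (q ^ b))
      ≤ hA χ (q ^ a) * hA χ (q ^ b) := by
  have ha : (0:ℝ) ≤ a := by positivity
  have hb : (0:ℝ) ≤ b := by positivity
  rcases chiA_cases h q with he | he | he
  · simp only [nuA_pp_zero h hq he, hA_pp_zero h hq he]; nlinarith
  · simp only [nuA_pp_one h hq he, hA_pp_one h hq he]
    push_cast
    have key : ∀ m : ℕ, ((m:ℝ) + 1) ^ 2 ≤ (m + 1) * (m + 2) * (m + 3) / 6 := by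
      intro m
      have : (0:ℝ) ≤ (m:ℝ) * (m - 1) := by
        rcases m with _ | m
        · simp
        · push_cast; rw [add_sub_cancel_right]; positivity
      have hm : (0:ℝ) ≤ m := by positivity
      nlinarith
    have k1 := key a
    have k2 := key b
    calc ((a:ℝ) + b + 1) * ((a + 1) * (b + 1)) ≤ ((a + 1) * (b + 1)) * ((a + 1) * (b + 1)) := by
          gcongr; nlinarith
      _ = ((a:ℝ) + 1) ^ 2 * (b + 1) ^ 2 := by ring
      _ ≤ _ := by gcongr
  · rcases Nat.even_or_odd a with ⟨a', rfl⟩ | h1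
    · rcases Nat.even_or_odd b with ⟨b', rfl⟩ | h2
      · rw [hA_pp_neg_even h hq he, hA_pp_neg_even h hq he]
        simp only [nuA_pp_neg h hq he]
        push_cast at ha hb
        simp [Nat.even_add]
        nlinarith
      · have : ¬ Even b := Nat.not_even_iff_odd.mpr h2
        rw [nuA_pp_neg h hq he b, if_neg this]
        simp only [mul_zero]
        exact mul_nonneg (hA_pp_nonneg h hq _) (hA_pp_nonneg h hq _)
    · have : ¬ Even a := Nat.not_even_iff_odd.mpr h1
      rw [nuA_pp_neg h hq he a, if_neg this]
      simp only [mul_zero, zero_mul]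
      exact mul_nonneg (hA_pp_nonneg h hq _) (hA_pp_nonneg h hq _)

lemma pp_ineq4 {D : ℕ} {χ : DirichletCharacter ℂ D} (h : IsRealChar χ) {q : ℕ} (hq : q.Prime)
    (a b : ℕ) : hA χ (q ^ (a + b)) * (nuA χ (q ^ a) * nuA χ (q ^ b))
      ≤ (nuA χ (q ^ a) * hA χ (q ^ a)) * (nuA χ (q ^ b) * hA χ (q ^ b)) := by
  have ha : (0:ℝ) ≤ a := by positivity
  have hb : (0:ℝ) ≤ b := by positivity
  rcases chiA_cases h q with he | he | he
  · simp only [nuA_pp_zero h hq he, hA_pp_zero h hq he]; push_cast; nlinarith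
  · simp only [nuA_pp_one h hq he, hA_pp_one h hq he]
    push_cast
    have key : ((a:ℝ) + b + 1) * (a + b + 2) * (a + b + 3) / 6
        ≤ ((a + 1) * (a + 2) * (a + 3) / 6) * ((b + 1) * (b + 2) * (b + 3) / 6) := by
      have k1 : ((a:ℝ) + b + 1) ≤ (a + 1) * (b + 1) := by nlinarith
      have k2 : ((a:ℝ) + b + 2) ≤ (a + 2) * (b + 2) / 2 := by nlinarith
      have k3 : ((a:ℝ) + b + 3) ≤ (a + 3) * (b + 3) / 3 := by nlinarith
      calc ((a:ℝ) + b + 1) * (a + b + 2) * (a + b + 3) / 6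
          ≤ ((a + 1) * (b + 1)) * ((a + 2) * (b + 2) / 2) * ((a + 3) * (b + 3) / 3) / 6 := by gcongr
        _ = _ := by ring
    have h0 : (0:ℝ) ≤ (a + 1) * (b + 1) := by positivity
    nlinarith [mul_le_mul_of_nonneg_right key h0]
  · rcases Nat.even_or_odd a with ⟨a', rfl⟩ | h1
    · rcases Nat.even_or_odd b with ⟨b', rfl⟩ | h2
      · rw [show a' + a' + (b' + b') = (a' + b') + (a' + b') by ring,
          hA_pp_neg_even h hq he, hA_pp_neg_even h hq he, hA_pp_neg_even h hq he]
        simp only [nuA_pp_neg h hq he]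
        push_cast at ha hb ⊢
        simp
        nlinarith
      · have : ¬ Even b := Nat.not_even_iff_odd.mpr h2
        rw [nuA_pp_neg h hq he b, if_neg this]
        simp
    · have : ¬ Even a := Nat.not_even_iff_odd.mpr h1
      rw [nuA_pp_neg h hq he a, if_neg this]
      simp

lemma nu_ineq6 {D : ℕ} {χ : DirichletCharacter ℂ D} (h : IsRealChar χ) (a b : ℕ) (ha : a ≠ 0)
    (hb : b ≠ 0) : nuA χ (a * b) * (nuA χ a * nuA χ b) ≤ hA χ a * hA χ b := by
  have hab : a * b ≠ 0 := mul_ne_zero ha hb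
  have sa : a.primeFactors ⊆ (a * b).primeFactors :=
    Nat.primeFactors_mono (dvd_mul_right _ _) hab
  have sb : b.primeFactors ⊆ (a * b).primeFactors :=
    Nat.primeFactors_mono (dvd_mul_left _ _) hab
  rw [mult_prod (nuA_mult h) hab _ (subset_refl _), mult_prod (nuA_mult h) ha _ sa,
    mult_prod (nuA_mult h) hb _ sb, mult_prod (hA_mult h) ha _ sa, mult_prod (hA_mult h) hb _ sb,
    ← Finset.prod_mul_distrib, ← Finset.prod_mul_distrib, ← Finset.prod_mul_distrib]
  refine Finset.prod_le_prod (fun p hp => ?_) (fun p hp => ?_)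
  all_goals have hq := Nat.prime_of_mem_primeFactors hp
  · exact mul_nonneg (nuA_pp_nonneg h hq _) (mul_nonneg (nuA_pp_nonneg h hq _) (nuA_pp_nonneg h hq _))
  · rw [Nat.factorization_mul ha hb]
    exact pp_ineq6 h hq _ _

lemma nu_ineq4 {D : ℕ} {χ : DirichletCharacter ℂ D} (h : IsRealChar χ) (a b : ℕ) (ha : a ≠ 0)
    (hb : b ≠ 0) : hA χ (a * b) * (nuA χ a * nuA χ b)
      ≤ (nuA χ a * hA χ a) * (nuA χ b * hA χ b) := by
  have hab : a * b ≠ 0 := mul_ne_zero ha hb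
  have sa : a.primeFactors ⊆ (a * b).primeFactors :=
    Nat.primeFactors_mono (dvd_mul_right _ _) hab
  have sb : b.primeFactors ⊆ (a * b).primeFactors :=
    Nat.primeFactors_mono (dvd_mul_left _ _) hab
  rw [mult_prod (hA_mult h) hab _ (subset_refl _), mult_prod (nuA_mult h) ha _ sa,
    mult_prod (nuA_mult h) hb _ sb, mult_prod (hA_mult h) ha _ sa, mult_prod (hA_mult h) hb _ sb,
    ← Finset.prod_mul_distrib, ← Finset.prod_mul_distrib, ← Finset.prod_mul_distrib,
    ← Finset.prod_mul_distrib, ← Finset.prod_mul_distrib]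
  refine Finset.prod_le_prod (fun p hp => ?_) (fun p hp => ?_)
  all_goals have hq := Nat.prime_of_mem_primeFactors hp
  · exact mul_nonneg (hA_pp_nonneg h hq _) (mul_nonneg (nuA_pp_nonneg h hq _) (nuA_pp_nonneg h hq _))
  · rw [Nat.factorization_mul ha hb]
    exact pp_ineq4 h hq _ _

/-- `υ` as a real arithmetic function. -/
def upsA {D : ℕ} (χ : DirichletCharacter ℂ D) : ArithmeticFunction ℝ :=
  (ArithmeticFunction.moebius : ArithmeticFunction ℝ) *
    (ArithmeticFunction.pmul (ArithmeticFunction.moebius : ArithmeticFunction ℝ) (chiA χ))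

lemma upsA_mult {D : ℕ} {χ : DirichletCharacter ℂ D} (h : IsRealChar χ) :
    (upsA χ).IsMultiplicative :=
  ArithmeticFunction.isMultiplicative_moebius.intCast.mul
    (ArithmeticFunction.isMultiplicative_moebius.intCast.pmul (chiA_mult h))

lemma upsA_pp_le {D : ℕ} {χ : DirichletCharacter ℂ D} (h : IsRealChar χ) {q : ℕ} (hq : q.Prime)
    (k : ℕ) : |upsA χ (q ^ k)| ≤ nuA χ (q ^ k) := by
  have mu2 : ∀ i : ℕ, ArithmeticFunction.moebius (q ^ (i + 2)) = 0 := by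
    intro i
    rw [ArithmeticFunction.moebius_apply_prime_pow hq (by omega), if_neg (by omega)]
  have mu1 := ArithmeticFunction.moebius_apply_prime hq
  rcases k with _ | _ | _ | k
  · simp [(upsA_mult h).map_one, (nuA_mult h).map_one]
  · have e : upsA χ (q ^ (0 + 1)) = -(1 + chiA χ q) := by
      unfold upsA
      rw [conv_pp _ _ hq]
      simp [Finset.sum_range_succ, mu1, (chiA_mult h).map_one]
    have e2 : nuA χ (q ^ (0 + 1)) = 1 + chiA χ q := by
      rw [nuA_pp h hq]; simp [Finset.sum_range_succ]
    rw [e, abs_neg, ← e2, abs_of_nonneg (nuA_pp_nonneg h hq _)]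
  · have e : upsA χ (q ^ (0 + 1 + 1)) = chiA χ q := by
      unfold upsA
      rw [conv_pp _ _ hq]
      have := mu2 0
      norm_num at this
      simp [Finset.sum_range_succ, mu1, (chiA_mult h).map_one, this]
    have e2 : nuA χ (q ^ (0 + 1 + 1)) = 1 + chiA χ q + chiA χ q ^ 2 := by
      rw [nuA_pp h hq]; simp [Finset.sum_range_succ]
    rw [e, e2]
    rcases chiA_cases h q with he | he | he <;> rw [he] <;> norm_num
  · have e : upsA χ (q ^ (k + 1 + 1 + 1)) = 0 := by
      unfold upsA
      rw [conv_pp _ _ hq]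
      refine Finset.sum_eq_zero fun i hi => ?_
      by_cases hi2 : 2 ≤ i
      · obtain ⟨j, rfl⟩ : ∃ j, i = j + 2 := ⟨i - 2, by omega⟩
        simp [mu2]
      · obtain ⟨j, hj⟩ : ∃ j, k + 1 + 1 + 1 - i = j + 2 := ⟨k + 1 - i, by omega⟩
        rw [hj]
        simp [mu2]
    rw [e, abs_zero]; exact nuA_pp_nonneg h hq _

lemma upsA_le {D : ℕ} {χ : DirichletCharacter ℂ D} (h : IsRealChar χ) (n : ℕ) :
    |upsA χ n| ≤ nuA χ n := by
  by_cases hn : n = 0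
  · simp [hn]
  rw [mult_prod (nuA_mult h) hn _ (subset_refl _), mult_prod (upsA_mult h) hn _ (subset_refl _),
    Finset.abs_prod]
  exact Finset.prod_le_prod (fun _ _ => abs_nonneg _)
    fun p hp => upsA_pp_le h (Nat.prime_of_mem_primeFactors hp) _

lemma nuA_mul_upsA {D : ℕ} {χ : DirichletCharacter ℂ D} (h : IsRealChar χ) :
    nuA χ * upsA χ = 1 := by
  have h1 : chiA χ * (ArithmeticFunction.pmul (ArithmeticFunction.moebius : ArithmeticFunction ℝ)
      (chiA χ)) = 1 := by
    have hz : (ArithmeticFunction.zeta : ArithmeticFunction ℝ)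
      * (ArithmeticFunction.moebius : ArithmeticFunction ℝ) = 1 := by
      exact ArithmeticFunction.coe_zeta_mul_coe_moebius
    ext n
    have h2 := congrArg (fun f => f n) hz
    simp only [ArithmeticFunction.mul_apply] at h2 ⊢
    have h3 : ∀ x ∈ n.divisorsAntidiagonal, chiA χ x.1 *
        (ArithmeticFunction.pmul (ArithmeticFunction.moebius : ArithmeticFunction ℝ) (chiA χ)) x.2
        = chiA χ n * ((ArithmeticFunction.zeta : ArithmeticFunction ℝ) x.1
      * (ArithmeticFunction.moebius : ArithmeticFunction ℝ) x.2) := by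
      intro x hx
      have hx' := Nat.mem_divisorsAntidiagonal.mp hx
      have hx1 : x.1 ≠ 0 := by rintro h0; rw [h0] at hx'; simp at hx'; omega
      rw [← hx'.1, chiA_mul h, ArithmeticFunction.pmul_apply, ArithmeticFunction.natCoe_apply,
        ArithmeticFunction.zeta_apply_ne hx1]
      push_cast
      ring
    rw [Finset.sum_congr rfl h3, ← Finset.mul_sum, h2]
    by_cases hn : n = 1
    · subst hn; simp [(chiA_mult h).map_one]
    · simp [ArithmeticFunction.one_apply_ne hn]
  have hz : (ArithmeticFunction.zeta : ArithmeticFunction ℝ)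
      * (ArithmeticFunction.moebius : ArithmeticFunction ℝ) = 1 :=
    ArithmeticFunction.coe_zeta_mul_coe_moebius
  unfold nuA upsA
  rw [mul_assoc, ← mul_assoc (ArithmeticFunction.zeta : ArithmeticFunction ℝ), hz, one_mul, h1]

/-- The weighted sum `∑_{a < n ≤ b} f(n) / n`. -/
def wsum (f : ℕ → ℝ) (a b : ℕ) : ℝ := ∑ n ∈ Finset.Ioc a b, f n / n

lemma wsum_nonneg {f : ℕ → ℝ} (hf : ∀ n, 0 ≤ f n) (a b : ℕ) : 0 ≤ wsum f a b :=
  Finset.sum_nonneg fun n _ => div_nonneg (hf n) (by positivity)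

lemma wsum_mono {f g : ℕ → ℝ} {a b : ℕ} (hf : ∀ n, n ≠ 0 → f n ≤ g n) :
    wsum f a b ≤ wsum g a b := by
  refine Finset.sum_le_sum fun n hn => ?_
  have := (Finset.mem_Ioc.1 hn).1
  have := hf n (by omega)
  gcongr

lemma anti_sum_le (G : ℕ → ℕ → ℝ) (hG : ∀ a b, 0 ≤ G a b) (X : ℕ) :
    ∑ n ∈ Finset.Ioc 0 X, ∑ x ∈ n.divisorsAntidiagonal, G x.1 x.2
      ≤ ∑ a ∈ Finset.Ioc 0 X, ∑ b ∈ Finset.Ioc 0 X, G a b := by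
  rw [← Finset.sum_biUnion, ← Finset.sum_product']
  · apply Finset.sum_le_sum_of_subset_of_nonneg
    · intro x hx
      rw [Finset.mem_biUnion] at hx
      obtain ⟨n, hn, hx⟩ := hx
      rw [Nat.mem_divisorsAntidiagonal] at hx
      rw [Finset.mem_Ioc] at hn
      rw [Finset.mem_product, Finset.mem_Ioc, Finset.mem_Ioc]
      have h1 : x.1 ≠ 0 := by rintro h; simp [h] at hx; omega
      have h2 : x.2 ≠ 0 := by rintro h; simp [h] at hx; omega
      have h3 : x.1 ≤ n := Nat.le_of_dvd hn.1 ⟨x.2, hx.1.symm⟩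
      have h4 : x.2 ≤ n := Nat.le_of_dvd hn.1 ⟨x.1, by rw [mul_comm]; exact hx.1.symm⟩
      omega
    · intros; exact hG _ _
  · intro m _ n _ hmn
    rw [Function.onFun, Finset.disjoint_left]
    intro x hx hy
    rw [Nat.mem_divisorsAntidiagonal] at hx hy
    exact hmn (hx.1.symm.trans hy.1)

lemma anti_sum_le' (f g : ℕ → ℝ) (hf : ∀ n, 0 ≤ f n) (hg : ∀ n, 0 ≤ g n) (Y X : ℕ) :
    ∑ n ∈ Finset.Ioc 0 X, ∑ x ∈ n.divisorsAntidiagonal,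
      (if Y < x.1 then f x.1 * g x.2 / n else 0) ≤ wsum f Y X * wsum g 0 X := by
  have h1 := anti_sum_le (fun a b => if Y < a then (f a / a) * (g b / b) else 0)
    (fun a b => by
      split_ifs
      · exact mul_nonneg (div_nonneg (hf _) (by positivity)) (div_nonneg (hg _) (by positivity))
      · rfl) X
  have e1 : ∑ n ∈ Finset.Ioc 0 X, ∑ x ∈ n.divisorsAntidiagonal,
      (if Y < x.1 then f x.1 * g x.2 / n else 0) = ∑ n ∈ Finset.Ioc 0 X,
        ∑ x ∈ n.divisorsAntidiagonal,
          (if Y < x.1 then (f x.1 / x.1) * (g x.2 / x.2) else 0) := by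
    refine Finset.sum_congr rfl fun n _ => Finset.sum_congr rfl fun x hx => ?_
    rw [Nat.mem_divisorsAntidiagonal] at hx
    rw [← hx.1]
    split_ifs
    · push_cast; rw [div_mul_div_comm]
    · rfl
  rw [e1]
  refine h1.trans (le_of_eq ?_)
  unfold wsum
  rw [Finset.sum_mul_sum]
  have : Finset.Ioc Y X = (Finset.Ioc 0 X).filter (fun a => Y < a) := by
    ext a; simp only [Finset.mem_filter, Finset.mem_Ioc]; omega
  rw [this, Finset.sum_filter]
  refine Finset.sum_congr rfl fun a _ => ?_
  split_ifs <;> simp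

lemma conv_all (f : ArithmeticFunction ℝ) (hf : ∀ n, 0 ≤ f n) (X : ℕ) :
    wsum (⇑(f * f)) 0 X ≤ wsum f 0 X ^ 2 := by
  have h1 := anti_sum_le' f f hf hf 0 X
  rw [sq]
  refine le_trans (le_of_eq ?_) h1
  unfold wsum
  refine Finset.sum_congr rfl fun n hn => ?_
  rw [ArithmeticFunction.mul_apply, Finset.sum_div]
  refine Finset.sum_congr rfl fun x hx => ?_
  rw [Nat.mem_divisorsAntidiagonal] at hx
  rw [if_pos]
  rcases Nat.eq_zero_or_pos x.1 with h | h
  · simp [h] at hx; omega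
  · exact h

lemma swap_anti (n : ℕ) (G : ℕ → ℕ → ℝ) :
    ∑ x ∈ n.divisorsAntidiagonal, G x.1 x.2 = ∑ x ∈ n.divisorsAntidiagonal, G x.2 x.1 := by
  rw [← Nat.map_swap_divisorsAntidiagonal, Finset.sum_map]
  simp

lemma tail_general (f : ℕ → ℝ) (hf : ∀ n, 0 ≤ f n) (c : ℕ → ℝ) (Y Z X : ℕ)
    (hc : ∀ n ∈ Finset.Ioc Z X, c n ≤ 2 * ∑ x ∈ n.divisorsAntidiagonal,
      (if Y < x.1 then f x.1 * f x.2 else 0)) :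
    wsum c Z X ≤ 2 * (wsum f Y X * wsum f 0 X) := by
  have h1 := anti_sum_le' f f hf hf Y X
  refine le_trans ?_ (mul_le_mul_of_nonneg_left h1 (by norm_num))
  rw [Finset.mul_sum]
  unfold wsum
  have h2 : ∀ n ∈ Finset.Ioc Z X, c n / n ≤ 2 * ∑ x ∈ n.divisorsAntidiagonal,
      (if Y < x.1 then f x.1 * f x.2 / n else 0) := by
    intro n hn
    have : (2 * ∑ x ∈ n.divisorsAntidiagonal, (if Y < x.1 then f x.1 * f x.2 / n else 0) : ℝ)
      = (2 * ∑ x ∈ n.divisorsAntidiagonal, (if Y < x.1 then f x.1 * f x.2 else 0)) / n := by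
      rw [mul_div_assoc, Finset.sum_div]
      congr 1
      refine Finset.sum_congr rfl fun x _ => ?_
      split_ifs <;> simp
    rw [this]
    have := hc n hn
    gcongr
  refine (Finset.sum_le_sum h2).trans ?_
  apply Finset.sum_le_sum_of_subset_of_nonneg
  · intro n hn; simp only [Finset.mem_Ioc] at hn ⊢; omega
  · intro n _ _
    refine mul_nonneg (by norm_num) (Finset.sum_nonneg fun x _ => ?_)
    split_ifs
    · exact div_nonneg (mul_nonneg (hf _) (hf _)) (by positivity)
    · rfl

lemma conv_tail (f : ArithmeticFunction ℝ) (hf : ∀ n, 0 ≤ f n) (Y X : ℕ) :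
    wsum (⇑(f * f)) (Y * Y) X ≤ 2 * (wsum f Y X * wsum f 0 X) := by
  apply tail_general f hf
  intro n hn
  rw [Finset.mem_Ioc] at hn
  have e := swap_anti n (fun a b => if Y < a then f a * f b else 0)
  rw [two_mul]
  nth_rewrite 2 [e]
  rw [← Finset.sum_add_distrib, ArithmeticFunction.mul_apply]
  refine Finset.sum_le_sum fun x hx => ?_
  rw [Nat.mem_divisorsAntidiagonal] at hx
  have h0 := mul_nonneg (hf x.1) (hf x.2)
  have h1 := mul_comm (f x.1) (f x.2)
  by_cases h2 : Y < x.1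
  · rw [if_pos h2]; split_ifs <;> linarith
  · by_cases h3 : Y < x.2
    · rw [if_pos h3]; split_ifs; linarith
    · push Not at h2 h3
      have := Nat.mul_le_mul h2 h3
      omega

lemma nuF_cast {D : ℕ} {χ : DirichletCharacter ℂ D} (h : IsRealChar χ) (n : ℕ) :
    nuF D χ n = (nuA χ n : ℂ) := by
  unfold nuF nuA
  rw [ArithmeticFunction.coe_mul_zeta_apply]
  push_cast
  refine Finset.sum_congr rfl fun d hd => ?_
  have : d ≠ 0 := (Nat.pos_of_mem_divisors hd).ne'
  apply Complex.ext <;> simp [chiA, this, h (d : ZMod D)]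

lemma upsF_cast {D : ℕ} {χ : DirichletCharacter ℂ D} (h : IsRealChar χ) (n : ℕ) :
    upsF D χ n = (upsA χ n : ℂ) := by
  unfold upsF upsA
  rw [ArithmeticFunction.mul_apply]
  rw [Nat.sum_divisorsAntidiagonal' (fun a b => ((ArithmeticFunction.moebius : ArithmeticFunction ℝ)) a *
    (ArithmeticFunction.pmul (ArithmeticFunction.moebius : ArithmeticFunction ℝ) (chiA χ)) b)]
  push_cast
  refine Finset.sum_congr rfl fun d hd => ?_
  have h0 : d ≠ 0 := (Nat.pos_of_mem_divisors hd).ne'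
  have : (χ (d : ZMod D)) = ((chiA χ d : ℝ) : ℂ) := by
    apply Complex.ext <;> simp [chiA, h0, h (d : ZMod D)]
  rw [this]
  simp [mul_assoc]

lemma sigF_cast {D : ℕ} {χ : DirichletCharacter ℂ D} (h : IsRealChar χ) (n : ℕ) :
    sigF D χ n = ((∑ x ∈ n.divisorsAntidiagonal,
      (if x.1 ≤ D ^ 4 ∧ x.2 ≤ D ^ 4 then nuA χ x.1 * upsA χ x.2 else 0) : ℝ) : ℂ) := by
  unfold sigF
  rw [Nat.sum_divisorsAntidiagonal
    (fun a b => if a ≤ D ^ 4 ∧ b ≤ D ^ 4 then nuA χ a * upsA χ b else 0)]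
  push_cast
  refine Finset.sum_congr rfl fun d hd => ?_
  rw [nuF_cast h, upsF_cast h]
  split_ifs <;> simp

lemma sigF_le_hA {D : ℕ} {χ : DirichletCharacter ℂ D} (h : IsRealChar χ) (n : ℕ) :
    ‖sigF D χ n‖ ≤ hA χ n := by
  rw [sigF_cast h, Complex.norm_real, Real.norm_eq_abs]
  unfold hA
  rw [ArithmeticFunction.mul_apply]
  refine (Finset.abs_sum_le_sum_abs _ _).trans (Finset.sum_le_sum fun x _ => ?_)
  have h1 := mul_nonneg (nuA_nonneg h x.1) (nuA_nonneg h x.2)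
  split_ifs
  · rw [abs_mul, abs_of_nonneg (nuA_nonneg h x.1)]
    exact mul_le_mul_of_nonneg_left (upsA_le h _) (nuA_nonneg h _)
  · simpa using h1

lemma sigF_le_tail {D : ℕ} {χ : DirichletCharacter ℂ D} (h : IsRealChar χ) (n : ℕ) (hn : 1 < n) :
    ‖sigF D χ n‖ ≤ 2 * ∑ x ∈ n.divisorsAntidiagonal,
      (if D ^ 4 < x.1 then nuA χ x.1 * nuA χ x.2 else 0) := by
  have h0 : ∑ x ∈ n.divisorsAntidiagonal, nuA χ x.1 * upsA χ x.2 = 0 := by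
    rw [← ArithmeticFunction.mul_apply, nuA_mul_upsA h, ArithmeticFunction.one_apply_ne (by omega)]
  have h1 : ∑ x ∈ n.divisorsAntidiagonal,
      (if x.1 ≤ D ^ 4 ∧ x.2 ≤ D ^ 4 then nuA χ x.1 * upsA χ x.2 else 0)
      = - ∑ x ∈ n.divisorsAntidiagonal,
      (if x.1 ≤ D ^ 4 ∧ x.2 ≤ D ^ 4 then 0 else nuA χ x.1 * upsA χ x.2) := by
    rw [eq_neg_iff_add_eq_zero, ← Finset.sum_add_distrib]
    refine Eq.trans ?_ h0
    refine Finset.sum_congr rfl fun x _ => ?_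
    split_ifs <;> simp
  rw [sigF_cast h, Complex.norm_real, Real.norm_eq_abs, h1, abs_neg]
  have e := swap_anti n (fun a b => if D ^ 4 < a then nuA χ a * nuA χ b else 0)
  rw [two_mul]
  nth_rewrite 2 [e]
  rw [← Finset.sum_add_distrib]
  refine (Finset.abs_sum_le_sum_abs _ _).trans (Finset.sum_le_sum fun x _ => ?_)
  have h2 := mul_nonneg (nuA_nonneg h x.1) (nuA_nonneg h x.2)
  have h3 := mul_comm (nuA χ x.1) (nuA χ x.2)
  have h4 : |nuA χ x.1 * upsA χ x.2| ≤ nuA χ x.1 * nuA χ x.2 := by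
    rw [abs_mul, abs_of_nonneg (nuA_nonneg h x.1)]
    exact mul_le_mul_of_nonneg_left (upsA_le h _) (nuA_nonneg h _)
  by_cases hx1 : D ^ 4 < x.1
  · rw [if_neg (by omega), if_pos hx1]
    split_ifs <;> linarith
  · by_cases hx2 : D ^ 4 < x.2
    · rw [if_neg (by omega), if_neg hx1, if_pos hx2]; linarith
    · rw [if_pos (by omega), if_neg hx1, if_neg hx2]; simp

/-- the product `ν · (ν * ν)` -/
def FA {D : ℕ} (χ : DirichletCharacter ℂ D) (n : ℕ) : ℝ := nuA χ n * hA χ n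

lemma sigF_sq {D : ℕ} {χ : DirichletCharacter ℂ D} (h : IsRealChar χ) (n : ℕ) (hn : 1 < n) :
    ‖sigF D χ n‖ ^ 2 ≤ 2 * ∑ x ∈ n.divisorsAntidiagonal,
      (if D ^ 4 < x.1 then FA χ x.1 * FA χ x.2 else 0) := by
  have h1 : ‖sigF D χ n‖ ^ 2 ≤ (2 * ∑ x ∈ n.divisorsAntidiagonal,
      (if D ^ 4 < x.1 then nuA χ x.1 * nuA χ x.2 else 0)) * hA χ n := by
    rw [sq]
    have := sigF_le_tail h n hn
    exact mul_le_mul this (sigF_le_hA h n) (norm_nonneg _) ((norm_nonneg _).trans this)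
  refine h1.trans ?_
  rw [mul_assoc, Finset.sum_mul]
  refine mul_le_mul_of_nonneg_left (Finset.sum_le_sum fun x hx => ?_) (by norm_num)
  rw [Nat.mem_divisorsAntidiagonal] at hx
  split_ifs
  · have := nu_ineq4 h x.1 x.2 (by rintro h; simp [h] at hx; omega)
      (by rintro h; simp [h] at hx; omega)
    rw [hx.1] at this
    unfold FA; linarith
  · simp

lemma FA_le {D : ℕ} {χ : DirichletCharacter ℂ D} (h : IsRealChar χ) (n : ℕ) :
    FA χ n ≤ (hA χ * hA χ) n := by
  unfold FA
  nth_rewrite 1 [hA]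
  rw [ArithmeticFunction.mul_apply, ArithmeticFunction.mul_apply, Finset.mul_sum]
  refine Finset.sum_le_sum fun x hx => ?_
  rw [Nat.mem_divisorsAntidiagonal] at hx
  rw [← hx.1]
  exact nu_ineq6 h x.1 x.2 (by rintro h; simp [h] at hx; omega)
      (by rintro h; simp [h] at hx; omega)

lemma S_bound {D : ℕ} {χ : DirichletCharacter ℂ D} (hD : 1 ≤ D) (h : IsRealChar χ) (X : ℕ) :
    wsum (fun n => ‖sigF D χ n‖ ^ 2) (D ^ 4) X
      ≤ 8 * (wsum (nuA χ) 0 X ^ 7 * wsum (nuA χ) D X) := by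
  have hF : ∀ n, 0 ≤ FA χ n := fun n => mul_nonneg (nuA_nonneg h n) (hA_nonneg h n)
  have h1 := tail_general (FA χ) hF (fun n => ‖sigF D χ n‖ ^ 2) (D ^ 4) (D ^ 4) X
    (fun n hn => sigF_sq h n (by
      have := (Finset.mem_Ioc.1 hn).1
      have := Nat.one_le_pow 4 D hD
      omega))
  have a1 : wsum (FA χ) 0 X ≤ wsum (⇑(hA χ * hA χ)) 0 X := wsum_mono fun n _ => FA_le h n
  have a2 : wsum (FA χ) (D ^ 4) X ≤ wsum (⇑(hA χ * hA χ)) (D ^ 4) X := wsum_mono fun n _ => FA_le h n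
  have b1 := conv_all (hA χ) (hA_nonneg h) X
  have b2 := conv_tail (hA χ) (hA_nonneg h) (D ^ 2) X
  have c1 : wsum (hA χ) 0 X ≤ wsum (nuA χ) 0 X ^ 2 := conv_all (nuA χ) (nuA_nonneg h) X
  have c2 : wsum (hA χ) (D * D) X ≤ 2 * (wsum (nuA χ) D X * wsum (nuA χ) 0 X) :=
    conv_tail (nuA χ) (nuA_nonneg h) D X
  rw [show D ^ 2 * D ^ 2 = D ^ 4 by ring, show D ^ 2 = D * D by ring] at b2
  have n0 := wsum_nonneg (nuA_nonneg h) 0 X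
  have n1 := wsum_nonneg (nuA_nonneg h) D X
  have m0 := wsum_nonneg (hA_nonneg h) 0 X
  have m1 := wsum_nonneg (hA_nonneg h) (D * D) X
  have f0 := wsum_nonneg hF 0 X
  have f1 := wsum_nonneg hF (D ^ 4) X
  set A := wsum (nuA χ) 0 X
  set B := wsum (nuA χ) D X
  have d1 : wsum (FA χ) 0 X ≤ A ^ 4 := by
    refine (a1.trans b1).trans ?_
    calc _ ≤ (A ^ 2) ^ 2 := by gcongr
      _ = A ^ 4 := by ring
  have d2 : wsum (FA χ) (D ^ 4) X ≤ 4 * (A ^ 3 * B) := by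
    refine (a2.trans b2).trans ?_
    calc _ ≤ 2 * ((2 * (B * A)) * A ^ 2) := by gcongr
      _ = _ := by ring
  refine h1.trans ?_
  calc _ ≤ 2 * ((4 * (A ^ 3 * B)) * A ^ 4) := by gcongr
    _ = _ := by ring

lemma H_eq (X : ℕ) : wsum (fun _ => 1) 0 X ≤ 1 + Real.log X := harmonic_real_le X

lemma nuA_le_d {D : ℕ} {χ : DirichletCharacter ℂ D} (h : IsRealChar χ) (n : ℕ) :
    nuA χ n ≤ ((ArithmeticFunction.zeta : ArithmeticFunction ℝ) * (ArithmeticFunction.zeta : ArithmeticFunction ℝ)) n := by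
  unfold nuA
  rw [ArithmeticFunction.mul_apply, ArithmeticFunction.mul_apply]
  refine Finset.sum_le_sum fun x hx => ?_
  rw [Nat.mem_divisorsAntidiagonal] at hx
  have h1 : x.1 ≠ 0 := by rintro h; simp [h] at hx; omega
  have h2 : x.2 ≠ 0 := by rintro h; simp [h] at hx; omega
  rcases chiA_cases h x.1 with e | e | e <;> simp [e, h1, h2]

lemma A0_bound {D : ℕ} {χ : DirichletCharacter ℂ D} (h : IsRealChar χ) (X : ℕ) :
    wsum (nuA χ) 0 X ≤ (1 + Real.log X) ^ 2 := by
  have hz : ∀ n, 0 ≤ (ArithmeticFunction.zeta : ArithmeticFunction ℝ) n := by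
    intro n
    rw [ArithmeticFunction.natCoe_apply]; positivity
  have h1 := conv_all (ArithmeticFunction.zeta : ArithmeticFunction ℝ) hz X
  have h2 : wsum (nuA χ) 0 X ≤ wsum (⇑((ArithmeticFunction.zeta : ArithmeticFunction ℝ) *
    (ArithmeticFunction.zeta : ArithmeticFunction ℝ))) 0 X := wsum_mono fun n _ => nuA_le_d h n
  have h3 : wsum (ArithmeticFunction.zeta : ArithmeticFunction ℝ) 0 X ≤ wsum (fun _ => 1) 0 X :=
    wsum_mono fun n hn => by simp [hn]
  have h4 := wsum_nonneg hz 0 X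
  have h5 := H_eq X
  refine (h2.trans h1).trans ?_
  gcongr
  linarith

lemma wsum_abel (f : ℕ → ℝ) (hf : ∀ n, 0 ≤ f n) (D : ℕ) (hD : 1 ≤ D) (c : ℝ) (hc : 0 ≤ c)
    (hT : ∀ y, D ≤ y → ∑ n ∈ Finset.Ioc 0 y, f n ≤ c * y) (X : ℕ) (hX : D ≤ X) :
    wsum f D X ≤ (∑ n ∈ Finset.Ioc 0 X, f n) / X + c * wsum (fun _ => 1) 0 X := by
  induction X, hX using Nat.le_induction with
  | base =>
    have h1 : wsum f D D = 0 := by simp [wsum]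
    rw [h1]
    have := wsum_nonneg (f := fun _ => 1) (fun _ => by norm_num) 0 D
    have : 0 ≤ (∑ n ∈ Finset.Ioc 0 D, f n) := Finset.sum_nonneg fun n _ => hf n
    positivity
  | succ X hX ih =>
    have h1 : wsum f D (X + 1) = wsum f D X + f (X + 1) / ((X + 1 : ℕ) : ℝ) := by
      unfold wsum; rw [Finset.sum_Ioc_succ_top (by omega)]
    have h2 : wsum (fun _ => 1) 0 (X + 1) = wsum (fun _ => 1) 0 X + 1 / ((X + 1 : ℕ) : ℝ) := by
      unfold wsum; rw [Finset.sum_Ioc_succ_top (by omega)]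
    rw [h1, h2, Finset.sum_Ioc_succ_top (by omega)]
    have h3 := hT X hX
    set T := ∑ n ∈ Finset.Ioc 0 X, f n
    have hX0 : (0:ℝ) < X := by exact_mod_cast (by omega : 0 < X)
    have h4 : T / X ≤ T / ((X + 1 : ℕ) : ℝ) + c * (1 / ((X + 1 : ℕ) : ℝ)) := by
      push_cast
      rw [div_le_iff₀ hX0]
      have : (T / (X + 1) + c * (1 / (X + 1))) * X = (T * X + c * X) / ((X:ℝ) + 1) := by
        field_simp
      rw [this, le_div_iff₀ (by positivity)]
      linarith
    rw [mul_add, add_div]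
    linarith

lemma T_bound {D : ℕ} {χ : DirichletCharacter ℂ D} (hD : 1 < D) (h : IsRealChar χ)
    (hp : χ.IsPrimitive) (ε : ℝ) (hε : 0 < ε) (hε1 : ε ≤ 1) (hL : (Lfun χ 1).re ≤ ε)
    (hM : Real.sqrt D * (1 + Real.log D) ≤ ε ^ 2 * D) (y : ℕ) (hy : D ≤ y) :
    ∑ n ∈ Finset.Ioc 0 y, nuA χ n ≤ (7 * ε) * y := by
  have hD1 : (1:ℝ) < D := by exact_mod_cast hD
  have hyD : (D:ℝ) ≤ y := by exact_mod_cast hy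
  have hy0 : (0:ℝ) < y := by linarith
  set M := Real.sqrt D * (1 + Real.log D) with hMdef
  have hM1 : 1 ≤ M := by
    have h1 : 1 ≤ Real.sqrt D := Real.one_le_sqrt.2 hD1.le
    have h2 := Real.log_nonneg hD1.le
    nlinarith
  have hMy : M ≤ ε ^ 2 * y := hM.trans (by gcongr)
  have hey : 1 ≤ ε * y := by nlinarith [mul_pos hε hy0]
  have hz1 : ε * y ≤ (⌈ε * y⌉₊ : ℝ) := Nat.le_ceil _
  have hz2 : (⌈ε * y⌉₊ : ℝ) < ε * y + 1 := Nat.ceil_lt_add_one (by positivity)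
  have hz3 : ⌈ε * y⌉₊ ≤ y := by
    rw [Nat.ceil_le]; nlinarith
  have hz4 : 1 ≤ ⌈ε * y⌉₊ := by
    have : (1:ℝ) ≤ (⌈ε * y⌉₊ : ℝ) := by linarith
    exact_mod_cast this
  have key := nu_summatory hD hp M (polya_vinogradov hD h hp) ⌈ε * y⌉₊ y hz4 hz3
  have h5 : 4 * M * y / (⌈ε * y⌉₊ : ℝ) ≤ 4 * ε * y := by
    rw [div_le_iff₀ (by linarith)]
    calc 4 * M * y ≤ 4 * (ε ^ 2 * y) * y := by gcongr
      _ = 4 * ε * y * (ε * y) := by ring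
      _ ≤ _ := by gcongr
  have h6 : (y:ℝ) * (Lfun χ 1).re ≤ y * ε := by gcongr
  linarith

lemma S_final {D : ℕ} {χ : DirichletCharacter ℂ D} (hD : 1 < D) (hL1 : 1 ≤ bigL D)
    (h : IsRealChar χ)
    (hp : χ.IsPrimitive) (ε : ℝ) (hε : 0 < ε) (hε1 : ε ≤ 1) (hL : (Lfun χ 1).re ≤ ε)
    (hM : Real.sqrt D * (1 + Real.log D) ≤ ε ^ 2 * D) :
    wsum (fun n => ‖sigF D χ n‖ ^ 2) (D ^ 4) (D ^ 8) ≤ (560 * 81 ^ 7) * (bigL D ^ 15 * ε) := by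
  have hS := S_bound hD.le h (D ^ 8)
  have hlog : Real.log ((D ^ 8 : ℕ) : ℝ) = 8 * bigL D := by
    push_cast; rw [Real.log_pow]; norm_num [bigL]
  have hA := A0_bound h (D ^ 8)
  have hH := H_eq (D ^ 8)
  rw [hlog] at hA hH
  have hT := T_bound hD h hp ε hε hε1 hL hM
  have hDX : D ≤ D ^ 8 := Nat.le_self_pow (by norm_num) D
  have hB := wsum_abel (nuA χ) (nuA_nonneg h) D hD.le (7 * ε) (by positivity) hT (D ^ 8) hDX
  have hT8 : (∑ n ∈ Finset.Ioc 0 (D ^ 8), nuA χ n) / ((D ^ 8 : ℕ) : ℝ) ≤ 7 * ε := by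
    rw [div_le_iff₀ (by positivity)]
    exact hT _ hDX
  have n0 := wsum_nonneg (nuA_nonneg h) 0 (D ^ 8)
  have n1 := wsum_nonneg (nuA_nonneg h) D (D ^ 8)
  have hA' : wsum (nuA χ) 0 (D ^ 8) ≤ 81 * bigL D ^ 2 := hA.trans (by nlinarith)
  have hB' : wsum (nuA χ) D (D ^ 8) ≤ 70 * (ε * bigL D) := by
    have h1 : 7 * ε * wsum (fun _ => 1) 0 (D ^ 8) ≤ 7 * ε * (1 + 8 * bigL D) := by gcongr
    have h2 : ε * 1 ≤ ε * bigL D := by gcongr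
    linarith
  refine hS.trans ?_
  calc _ ≤ 8 * ((81 * bigL D ^ 2) ^ 7 * (70 * (ε * bigL D))) := by gcongr
    _ = _ := by ring

lemma mean_value {p : ℕ} (hp : p.Prime) (a : ℕ → ℂ) (s : Finset ℕ)
    (hs : ∀ n ∈ s, 0 < n ∧ n < p) :
    haveI : NeZero p := ⟨hp.ne_zero⟩
    ∑ ψ : DirichletCharacter ℂ p, ‖∑ n ∈ s, a n * ψ (n : ZMod p)‖ ^ 2
      ≤ p * ∑ n ∈ s, ‖a n‖ ^ 2 := by
  haveI : NeZero p := ⟨hp.ne_zero⟩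
  haveI : Fact p.Prime := ⟨hp⟩
  have key : ∑ ψ : DirichletCharacter ℂ p, ‖∑ n ∈ s, a n * ψ (n : ZMod p)‖ ^ 2
      = (p.totient : ℝ) * ∑ n ∈ s, ‖a n‖ ^ 2 := by
    have h1 : ((∑ ψ : DirichletCharacter ℂ p, ‖∑ n ∈ s, a n * ψ (n : ZMod p)‖ ^ 2 : ℝ) : ℂ)
        = (((p.totient : ℝ) * ∑ n ∈ s, ‖a n‖ ^ 2 : ℝ) : ℂ) := by
      push_cast
      calc _ = ∑ ψ : DirichletCharacter ℂ p, ∑ m ∈ s, ∑ n ∈ s,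
            (a m * (starRingEnd ℂ) (a n)) * (ψ (n : ZMod p)⁻¹ * ψ (m : ZMod p)) := by
            refine Finset.sum_congr rfl fun ψ _ => ?_
            rw [← Complex.mul_conj', map_sum, Finset.sum_mul_sum]
            refine Finset.sum_congr rfl fun m _ => Finset.sum_congr rfl fun n _ => ?_
            have : (starRingEnd ℂ) (ψ (n : ZMod p)) = ψ (n : ZMod p)⁻¹ := by
              have := MulChar.star_apply' ψ (n : ZMod p)
              rw [MulChar.inv_apply'] at this
              exact this
            rw [map_mul, this]; ring
        _ = ∑ m ∈ s, ∑ n ∈ s, (a m * (starRingEnd ℂ) (a n)) *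
              (∑ ψ : DirichletCharacter ℂ p, ψ (n : ZMod p)⁻¹ * ψ (m : ZMod p)) := by
            rw [Finset.sum_comm]
            refine Finset.sum_congr rfl fun m _ => ?_
            rw [Finset.sum_comm]
            refine Finset.sum_congr rfl fun n _ => ?_
            rw [Finset.mul_sum]
        _ = ∑ m ∈ s, (p.totient : ℂ) * (‖a m‖ : ℂ) ^ 2 := by
            refine Finset.sum_congr rfl fun m hm => ?_
            rw [Finset.sum_eq_single m]
            · have hu : IsUnit (m : ZMod p) := by
                rw [ZMod.isUnit_iff_coprime]
                exact (Nat.coprime_of_lt_prime (hs m hm).1.ne' (hs m hm).2 hp).symm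
              rw [DirichletCharacter.sum_char_inv_mul_char_eq ℂ hu, if_pos rfl, Complex.mul_conj']
              ring
            · intro n hn hnm
              have hu : IsUnit (n : ZMod p) := by
                rw [ZMod.isUnit_iff_coprime]
                exact (Nat.coprime_of_lt_prime (hs n hn).1.ne' (hs n hn).2 hp).symm
              rw [DirichletCharacter.sum_char_inv_mul_char_eq ℂ hu, if_neg, mul_zero]
              rw [ZMod.natCast_eq_natCast_iff', Nat.mod_eq_of_lt (hs n hn).2,
                Nat.mod_eq_of_lt (hs m hm).2]
              exact hnm
            · exact fun h => absurd hm h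
        _ = _ := by rw [Finset.mul_sum]
    exact_mod_cast h1
  rw [key]
  have : (p.totient : ℝ) ≤ p := by exact_mod_cast Nat.totient_le p
  gcongr

lemma s0_norm (D n : ℕ) (hn : 0 < n) : ‖(n : ℂ) ^ (-s0 D)‖ ^ 2 = 1 / (n : ℝ) := by
  rw [Complex.norm_natCast_cpow_of_pos hn]
  have : (-s0 D).re = -(1 / 2) := by
    simp [s0]
  rw [this, ← Real.rpow_natCast, ← Real.rpow_mul (by positivity)]
  norm_num
  rw [Real.rpow_neg_one]

lemma X4_mean {D p : ℕ} (χ : DirichletCharacter ℂ D) (hp : p.Prime) (hpD : D ^ 8 < p)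
    (x : ℝ) (hx : x ≤ (D : ℝ) ^ 8) :
    haveI : NeZero p := ⟨hp.ne_zero⟩
    ∑ ψ : DirichletCharacter ℂ p, ‖X4 D χ ψ x‖ ^ 2
      ≤ p * wsum (fun n => ‖sigF D χ n‖ ^ 2) (D ^ 4) (D ^ 8) := by
  have hfl : ⌊x⌋₊ ≤ D ^ 8 := by
    apply Nat.floor_le_of_le
    push_cast; exact hx
  have h1 := mean_value hp (fun n => sigF D χ n * (n : ℂ) ^ (-s0 D))
    (Finset.Ioc (D ^ 4) ⌊x⌋₊) (fun n hn => by rw [Finset.mem_Ioc] at hn; omega)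
  refine le_trans (le_of_eq ?_) (h1.trans ?_)
  · refine Finset.sum_congr rfl fun ψ _ => ?_
    unfold X4
    congr 2
    refine Finset.sum_congr rfl fun n _ => ?_
    ring
  · refine mul_le_mul_of_nonneg_left ?_ (by positivity)
    unfold wsum
    have : ∀ n ∈ Finset.Ioc (D ^ 4) ⌊x⌋₊, ‖sigF D χ n * (n : ℂ) ^ (-s0 D)‖ ^ 2
        = ‖sigF D χ n‖ ^ 2 / n := by
      intro n hn
      rw [Finset.mem_Ioc] at hn
      rw [norm_mul, mul_pow, s0_norm D n (by omega)]
      ring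
    rw [Finset.sum_congr rfl this]
    apply Finset.sum_le_sum_of_subset_of_nonneg
    · intro n hn; rw [Finset.mem_Ioc] at hn ⊢; omega
    · intros; positivity

lemma floor_integrable (φ : ℕ → ℝ) (a b : ℝ) (ha : 1 ≤ a) (hab : a ≤ b) :
    IntervalIntegrable (fun x => φ ⌊x⌋₊ / x) MeasureTheory.volume a b := by
  rw [intervalIntegrable_iff_integrableOn_Icc_of_le hab]
  have hm : Measurable (fun x : ℝ => φ ⌊x⌋₊ / x) :=
    ((measurable_from_nat (f := φ)).comp Nat.measurable_floor).div measurable_id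
  refine MeasureTheory.Measure.integrableOn_of_bounded
    (M := ∑ n ∈ Finset.range (⌊b⌋₊ + 1), |φ n|) (by simp) hm.aestronglyMeasurable ?_
  rw [MeasureTheory.ae_restrict_iff' measurableSet_Icc]
  refine Filter.Eventually.of_forall fun x hx => ?_
  have hx1 : 1 ≤ x := ha.trans hx.1
  rw [norm_div, Real.norm_eq_abs, Real.norm_eq_abs, abs_of_pos (by linarith : 0 < x)]
  refine (div_le_self (abs_nonneg _) hx1).trans ?_
  apply Finset.single_le_sum (f := fun n => |φ n|) (fun n _ => abs_nonneg _)
  rw [Finset.mem_range]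
  have := Nat.floor_mono hx.2
  omega

lemma log_integral {D : ℕ} (hD : 1 < D) :
    ∫ x in ((D : ℝ) ^ 4)..((D : ℝ) ^ 8), 1 / x = 4 * bigL D := by
  have hD1 : (0:ℝ) < D := by exact_mod_cast (by omega : 0 < D)
  rw [integral_one_div_of_pos (by positivity) (by positivity)]
  have : (D:ℝ) ^ 8 / (D:ℝ) ^ 4 = (D:ℝ) ^ 4 := by field_simp
  rw [this, Real.log_pow]
  norm_num [bigL]

lemma bad_bound {D p : ℕ} (hD : 1 < D) (hL1 : 1 ≤ bigL D) (χ : DirichletCharacter ℂ D)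
    (ψ : DirichletCharacter ℂ p) (e : ℝ) (he : 0 < e)
    (hbad : e ≤ ‖X4 D χ ψ ((D : ℝ) ^ 8)‖ +
      ∫ x in ((D : ℝ) ^ 4)..((D : ℝ) ^ 8), ‖X4 D χ ψ x‖ / x) :
    1 ≤ 2 / e ^ 2 * (‖X4 D χ ψ ((D : ℝ) ^ 8)‖ ^ 2 +
      4 * bigL D * ∫ x in ((D : ℝ) ^ 4)..((D : ℝ) ^ 8), ‖X4 D χ ψ x‖ ^ 2 / x) := by
  have hD1 : (1:ℝ) ≤ D := by exact_mod_cast hD.le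
  have h4 : (1:ℝ) ≤ (D:ℝ) ^ 4 := one_le_pow₀ hD1
  have h48 : (D:ℝ) ^ 4 ≤ (D:ℝ) ^ 8 := pow_le_pow_right₀ hD1 (by norm_num)
  have i1 : IntervalIntegrable (fun x => ‖X4 D χ ψ x‖ / x) MeasureTheory.volume
      ((D : ℝ) ^ 4) ((D : ℝ) ^ 8) :=
    floor_integrable (fun k => ‖∑ n ∈ Finset.Ioc (D ^ 4) k,
      sigF D χ n * ψ (n : ZMod p) * (n : ℂ) ^ (-s0 D)‖) _ _ h4 h48
  have i2 : IntervalIntegrable (fun x => ‖X4 D χ ψ x‖ ^ 2 / x) MeasureTheory.volume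
      ((D : ℝ) ^ 4) ((D : ℝ) ^ 8) :=
    floor_integrable (fun k => ‖∑ n ∈ Finset.Ioc (D ^ 4) k,
      sigF D χ n * ψ (n : ZMod p) * (n : ℂ) ^ (-s0 D)‖ ^ 2) _ _ h4 h48
  have i3 : IntervalIntegrable (fun x : ℝ => 1 / x) MeasureTheory.volume
      ((D : ℝ) ^ 4) ((D : ℝ) ^ 8) := floor_integrable (fun _ => 1) _ _ h4 h48
  set L := bigL D with hLdef
  have hL0 : 0 < L := by linarith
  have hI : ∫ x in ((D : ℝ) ^ 4)..((D : ℝ) ^ 8), ‖X4 D χ ψ x‖ / x ≤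
      ∫ x in ((D : ℝ) ^ 4)..((D : ℝ) ^ 8),
        ((4 * L / e) * (‖X4 D χ ψ x‖ ^ 2 / x) + (e / (16 * L)) * (1 / x)) := by
    apply intervalIntegral.integral_mono_on h48 i1 ((i2.const_mul _).add (i3.const_mul _))
    intro x hx
    have hx0 : 0 < x := by linarith [hx.1]
    set g := ‖X4 D χ ψ x‖
    have hg : g ≤ (4 * L / e) * g ^ 2 + e / (16 * L) := by
      have : (4 * L / e) * g ^ 2 + e / (16 * L) - g = (8 * L * g - e) ^ 2 / (16 * L * e) := by
        field_simp; ring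
      have h0 : 0 ≤ (8 * L * g - e) ^ 2 / (16 * L * e) := by positivity
      linarith
    calc g / x ≤ ((4 * L / e) * g ^ 2 + e / (16 * L)) / x := by gcongr
      _ = _ := by ring
  rw [intervalIntegral.integral_add (i2.const_mul _) (i3.const_mul _),
    intervalIntegral.integral_const_mul, intervalIntegral.integral_const_mul,
    log_integral hD] at hI
  set I := ∫ x in ((D : ℝ) ^ 4)..((D : ℝ) ^ 8), ‖X4 D χ ψ x‖ ^ 2 / x
  set u := ‖X4 D χ ψ ((D : ℝ) ^ 8)‖
  have hu : u ≤ u ^ 2 / e + e / 4 := by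
    have : u ^ 2 / e + e / 4 - u = (2 * u - e) ^ 2 / (4 * e) := by field_simp; ring
    have h0 : 0 ≤ (2 * u - e) ^ 2 / (4 * e) := by positivity
    linarith
  have h5 : e / (16 * L) * (4 * bigL D) = e / 4 := by rw [← hLdef]; field_simp; norm_num
  rw [h5] at hI
  have h6 : e / 2 ≤ u ^ 2 / e + 4 * L / e * I := by linarith
  have h7 : 2 / e ^ 2 * (u ^ 2 + 4 * L * I) = (2 / e) * (u ^ 2 / e + 4 * L / e * I) := by
    field_simp
  rw [h7]
  calc 1 = (2 / e) * (e / 2) := by field_simp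
    _ ≤ _ := by gcongr

lemma count_bound {D p : ℕ} (hD : 1 < D) (hL1 : 1 ≤ bigL D) (χ : DirichletCharacter ℂ D)
    (hp : p.Prime) (hpD : D ^ 8 < p) :
    (Nat.card {ψ : DirichletCharacter ℂ p // ψ.IsPrimitive ∧ ¬Ineq3 D χ ψ} : ℝ) ≤
      34 * bigL D ^ 1268 * (p * wsum (fun n => ‖sigF D χ n‖ ^ 2) (D ^ 4) (D ^ 8)) := by
  haveI : NeZero p := ⟨hp.ne_zero⟩
  have hD1 : (1:ℝ) ≤ D := by exact_mod_cast hD.le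
  have h4 : (1:ℝ) ≤ (D:ℝ) ^ 4 := one_le_pow₀ hD1
  have h48 : (D:ℝ) ^ 4 ≤ (D:ℝ) ^ 8 := pow_le_pow_right₀ hD1 (by norm_num)
  have hL0 : 0 < bigL D := by linarith
  set L := bigL D with hLdef
  set S := wsum (fun n => ‖sigF D χ n‖ ^ 2) (D ^ 4) (D ^ 8) with hS
  have hS0 : 0 ≤ S := wsum_nonneg (fun _ => by positivity) _ _
  have he : (0:ℝ) < L ^ (-633 : ℤ) := by positivity
  set e : ℝ := L ^ (-633 : ℤ) with hedef
  have i2 : ∀ ψ : DirichletCharacter ℂ p, IntervalIntegrable (fun x => ‖X4 D χ ψ x‖ ^ 2 / x)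
      MeasureTheory.volume ((D : ℝ) ^ 4) ((D : ℝ) ^ 8) := fun ψ =>
    floor_integrable (fun k => ‖∑ n ∈ Finset.Ioc (D ^ 4) k,
      sigF D χ n * ψ (n : ZMod p) * (n : ℂ) ^ (-s0 D)‖ ^ 2) _ _ h4 h48
  have i3 : IntervalIntegrable (fun x : ℝ => 1 / x) MeasureTheory.volume
      ((D : ℝ) ^ 4) ((D : ℝ) ^ 8) := floor_integrable (fun _ => 1) _ _ h4 h48
  have hI0 : ∀ ψ : DirichletCharacter ℂ p,
      0 ≤ ∫ x in ((D : ℝ) ^ 4)..((D : ℝ) ^ 8), ‖X4 D χ ψ x‖ ^ 2 / x := fun ψ =>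
    intervalIntegral.integral_nonneg h48 fun x hx => by
      have : 0 < x := by linarith [hx.1]
      positivity
  have hc : (Nat.card {ψ : DirichletCharacter ℂ p // ψ.IsPrimitive ∧ ¬Ineq3 D χ ψ} : ℝ)
      ≤ ∑ ψ : DirichletCharacter ℂ p, 2 / e ^ 2 * (‖X4 D χ ψ ((D : ℝ) ^ 8)‖ ^ 2 +
      4 * L * ∫ x in ((D : ℝ) ^ 4)..((D : ℝ) ^ 8), ‖X4 D χ ψ x‖ ^ 2 / x) := by
    rw [Nat.card_eq_fintype_card, Fintype.card_subtype, Finset.card_eq_sum_ones]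
    push_cast
    rw [Finset.sum_filter]
    refine Finset.sum_le_sum fun ψ _ => ?_
    split_ifs with hψ
    · refine bad_bound hD hL1 χ ψ e he ?_
      have := hψ.2
      unfold Ineq3 at this
      exact not_lt.1 this
    · have := hI0 ψ
      positivity
  refine hc.trans ?_
  rw [← Finset.mul_sum, Finset.sum_add_distrib, ← Finset.mul_sum,
    ← intervalIntegral.integral_finsetSum (fun ψ _ => i2 ψ)]
  have m1 := X4_mean χ hp hpD ((D:ℝ) ^ 8) le_rfl
  have m2 : ∫ x in ((D : ℝ) ^ 4)..((D : ℝ) ^ 8),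
      ∑ ψ : DirichletCharacter ℂ p, ‖X4 D χ ψ x‖ ^ 2 / x ≤
      ∫ x in ((D : ℝ) ^ 4)..((D : ℝ) ^ 8), (p * S) * (1 / x) := by
    apply intervalIntegral.integral_mono_on h48 _ (i3.const_mul _)
    · intro x hx
      have hx0 : 0 < x := by linarith [hx.1]
      rw [← Finset.sum_div, mul_one_div]
      have := X4_mean χ hp hpD x hx.2
      gcongr
    · exact (IntervalIntegrable.sum Finset.univ (fun ψ _ => i2 ψ)).congr
        (by intro x _; simp)
  rw [intervalIntegral.integral_const_mul, log_integral hD, ← hLdef] at m2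
  have e2 : 2 / e ^ 2 = 2 * L ^ 1266 := by
    rw [hedef, ← zpow_natCast, ← zpow_mul]
    norm_num
  rw [e2]
  have hpS : 0 ≤ p * S := by positivity
  calc _ ≤ 2 * L ^ 1266 * (p * S + 4 * L * (p * S * (4 * L))) := by gcongr
    _ = 2 * L ^ 1266 * ((p * S) * (1 + 16 * L ^ 2)) := by ring
    _ ≤ 2 * L ^ 1266 * ((p * S) * (17 * L ^ 2)) := by
      have : 1 ≤ L ^ 2 := one_le_pow₀ hL1
      gcongr
      linarith
    _ = _ := by ring

lemma eventual_conditions : ∃ D₀ : ℕ, ∀ D : ℕ, D₀ ≤ D →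
    2 ≤ bigL D ∧ bigL D ^ 4046 ≤ Real.exp (1 / 2 * bigL D) := by
  have h1 : Filter.Tendsto (fun D : ℕ => bigL D) Filter.atTop Filter.atTop :=
    Real.tendsto_log_atTop.comp tendsto_natCast_atTop_atTop
  have h2 := (isLittleO_pow_exp_pos_mul_atTop 4046 (b := 1 / 2) (by norm_num)).bound
    (c := 1) (by norm_num)
  have h3 := (h1.eventually h2).and (h1.eventually (Filter.eventually_ge_atTop 2))
  obtain ⟨D₀, hD₀⟩ := Filter.eventually_atTop.1 h3
  refine ⟨D₀, fun D hD => ?_⟩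
  obtain ⟨h4, h5⟩ := hD₀ D hD
  refine ⟨h5, ?_⟩
  rw [one_mul, Real.norm_of_nonneg (by positivity), Real.norm_of_nonneg (by positivity)] at h4
  exact h4

/-- Under (A), the number of `ψ ∈ Ψ` for which (3.6) fails is
`≤ C 𝒫 𝓛^{-739}`. -/
theorem statement6 :
    ∃ C : ℝ, 0 < C ∧ ∃ D₀ : ℕ, ∀ D : ℕ, D₀ ≤ D → ∀ χ : DirichletCharacter ℂ D,
      IsRealChar χ → χ.IsPrimitive → AssumptionA D χ →
        (∑ p ∈ primesP D,
            (Nat.card {ψ : DirichletCharacter ℂ p // ψ.IsPrimitive ∧ ¬Ineq3 D χ ψ} : ℝ)) ≤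
          C * calP D * bigL D ^ (-739 : ℤ) := by
  obtain ⟨D₀, hD₀⟩ := eventual_conditions
  refine ⟨34 * (560 * 81 ^ 7), by norm_num, D₀, fun D hD χ hr hp hA => ?_⟩
  obtain ⟨hL2, hexp⟩ := hD₀ D hD
  have hD1 : 1 < D := by
    by_contra hcon
    have : D = 0 ∨ D = 1 := by omega
    rcases this with h | h <;> simp [bigL, h] at hL2 <;> linarith
  have hDpos : (0:ℝ) < D := by exact_mod_cast (by omega : 0 < D)
  have hL0 : 0 < bigL D := by linarith
  have hL1 : 1 ≤ bigL D := by linarith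
  have hDexp : (D:ℝ) = Real.exp (bigL D) := by rw [bigL, Real.exp_log hDpos]
  have hsqrt : Real.sqrt D = Real.exp (1 / 2 * bigL D) := by
    rw [hDexp, Real.sqrt_eq_iff_mul_self_eq (Real.exp_pos _).le (Real.exp_pos _).le, ← Real.exp_add]
    rw [show 1 / 2 * bigL D + 1 / 2 * bigL D = bigL D by ring]
  have hsq : Real.sqrt D * Real.sqrt D = D := Real.mul_self_sqrt hDpos.le
  have hε : 0 < bigL D ^ (-2022 : ℤ) := by positivity
  have hε1 : bigL D ^ (-2022 : ℤ) ≤ 1 := zpow_le_one_of_nonpos₀ hL1 (by norm_num)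
  have hM : Real.sqrt D * (1 + Real.log D) ≤ (bigL D ^ (-2022 : ℤ)) ^ 2 * D := by
    have e1 : (bigL D ^ (-2022 : ℤ)) ^ 2 = (bigL D ^ 4044)⁻¹ := by
      rw [← zpow_natCast, ← zpow_mul, ← zpow_natCast, ← zpow_neg]; norm_num
    rw [e1, inv_mul_eq_div, le_div_iff₀ (by positivity)]
    have e2 : (1 + Real.log D) * bigL D ^ 4044 ≤ Real.sqrt D := by
      rw [hsqrt]
      refine le_trans ?_ hexp
      change (1 + bigL D) * _ ≤ _
      rw [show bigL D ^ 4046 = bigL D ^ 2 * bigL D ^ 4044 by rw [← pow_add]]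
      gcongr
      nlinarith
    calc _ = Real.sqrt D * ((1 + Real.log D) * bigL D ^ 4044) := by ring
      _ ≤ Real.sqrt D * Real.sqrt D := by gcongr
      _ = D := hsq
  have hS := S_final hD1 hL1 hr hp _ hε hε1 (le_of_lt hA) hM
  have hP : ((D ^ 8 : ℕ) : ℝ) < bigP D := by
    push_cast
    rw [hDexp, ← Real.exp_nat_mul, bigP]
    apply Real.exp_lt_exp.2
    have h8 : (2:ℝ) ^ 8 ≤ bigL D ^ 8 := by gcongr
    calc ((8:ℕ):ℝ) * bigL D < 2 ^ 8 * bigL D := by push_cast; nlinarith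
      _ ≤ bigL D ^ 8 * bigL D := by gcongr
      _ = _ := by ring
  have hcount : ∀ p ∈ primesP D,
      (Nat.card {ψ : DirichletCharacter ℂ p // ψ.IsPrimitive ∧ ¬Ineq3 D χ ψ} : ℝ) ≤
      34 * (560 * 81 ^ 7) * bigL D ^ (-739 : ℤ) * p := by
    intro p hpm
    obtain ⟨hpp, hp1, _⟩ := (Finset.mem_filter.1 hpm).2
    have hpD : D ^ 8 < p := by
      have := hP.trans hp1
      exact_mod_cast this
    refine (count_bound hD1 hL1 χ hpp hpD).trans ?_
    have e3 : bigL D ^ 1268 * (bigL D ^ 15 * bigL D ^ (-2022 : ℤ)) = bigL D ^ (-739 : ℤ) := by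
      rw [← zpow_natCast, ← zpow_natCast, ← zpow_add₀ hL0.ne', ← zpow_add₀ hL0.ne']; norm_num
    rw [← e3]
    calc _ ≤ 34 * bigL D ^ 1268 *
          (p * ((560 * 81 ^ 7) * (bigL D ^ 15 * bigL D ^ (-2022 : ℤ)))) := by gcongr
      _ = _ := by ring
  refine (Finset.sum_le_sum hcount).trans (le_of_eq ?_)
  rw [← Finset.mul_sum, calP]; ring

end
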